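/- Let h(u,v) = \sum_{i=0}^{12} \binom{12}{i} \alpha_i u^i v^{12-i} with (\alpha_0, \dots, \alpha_{12}) = (-64, -64, -32, -16, -16, -32, -424/7, -76, -68, -28, 134, 859, 2207). Define g = (1/132^2)(h_{uu} h_{vv} - h_{uv}^2) and f = (1/240)(h_u g_v - h_v g_u), where subscripts denote partial derivatives with respect to u and v; then f is a binary form of degree 30 with integer coefficients. There are no integers u, v, y with (u, v) \neq (0, 0) and y^2 = -f(u, v). -/

import Mathlib

open MvPolynomial

/-- The coefficient vector `(α₀, …, α₁₂)`. -/
noncomputable def alphaC38 : Fin 13 → ℚ := ![-64, -64, -32, -16, -16, -32, -424/7, -76, -68, -28, 134, 859, 2207]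

/-- The binary form `h(u,v) = ∑ i, (12 choose i) αᵢ uⁱ v^(12-i)`,
as a polynomial in the two variables `X 0 = u` and `X 1 = v`. -/
noncomputable def hC38 : MvPolynomial (Fin 2) ℚ :=
  ∑ i : Fin 13, C ((Nat.choose 12 i : ℚ) * alphaC38 i) * X 0 ^ (i : ℕ) * X 1 ^ (12 - (i : ℕ))

/-- `g = (1/132²)·(h_uu h_vv - h_uv²)`. -/
noncomputable def gC38 : MvPolynomial (Fin 2) ℚ :=
  C ((1 : ℚ) / 132 ^ 2) *
    (pderiv 0 (pderiv 0 hC38) * pderiv 1 (pderiv 1 hC38) -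
      pderiv 1 (pderiv 0 hC38) * pderiv 1 (pderiv 0 hC38))

/-- `f = (1/240)·(h_u g_v - h_v g_u)`. -/
noncomputable def fC38 : MvPolynomial (Fin 2) ℚ :=
  C ((1 : ℚ) / 240) *
    (pderiv 0 hC38 * pderiv 1 gC38 - pderiv 1 hC38 * pderiv 0 gC38)



namespace C38

def N5 {R : Type*} [CommRing R] (x0 x1 x2 x3 x4 : R) : R :=
    (x0*(x0+15*x4) - x1*6*x4)*((x0+15*x4+10*x3)*((x0+15*x4+10*x3)*(x0+15*x4+10*x3) -
    (x1+10*x4)*(6*x4+15*x3+10*x2)) - (x1+10*x4)*((6*x4+15*x3+10*x2)*(x0+15*x4+10*x3) -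
    (x1+10*x4)*(6*x3+15*x2+10*(x1+10*x4))) + x2*((6*x4+15*x3+10*x2)*(6*x4+15*x3+10*x2) -
    (x0+15*x4+10*x3)*(6*x3+15*x2+10*(x1+10*x4)))) - (x0*(x1+10*x4) -
    x2*6*x4)*((6*x4+15*x3)*((x0+15*x4+10*x3)*(x0+15*x4+10*x3) - (x1+10*x4)*(6*x4+15*x3+10*x2))
    - (x1+10*x4)*((6*x3+15*x2)*(x0+15*x4+10*x3) - (x1+10*x4)*(6*x2+15*(x1+10*x4))) +
    x2*((6*x3+15*x2)*(6*x4+15*x3+10*x2) - (x0+15*x4+10*x3)*(6*x2+15*(x1+10*x4)))) + (x0*x2 -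
    x3*6*x4)*((6*x4+15*x3)*((6*x4+15*x3+10*x2)*(x0+15*x4+10*x3) -
    (x1+10*x4)*(6*x3+15*x2+10*(x1+10*x4))) - (x0+15*x4+10*x3)*((6*x3+15*x2)*(x0+15*x4+10*x3) -
    (x1+10*x4)*(6*x2+15*(x1+10*x4))) + x2*((6*x3+15*x2)*(6*x3+15*x2+10*(x1+10*x4)) -
    (6*x4+15*x3+10*x2)*(6*x2+15*(x1+10*x4)))) - (x0*x3 -
    x4*6*x4)*((6*x4+15*x3)*((6*x4+15*x3+10*x2)*(6*x4+15*x3+10*x2) -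
    (x0+15*x4+10*x3)*(6*x3+15*x2+10*(x1+10*x4))) -
    (x0+15*x4+10*x3)*((6*x3+15*x2)*(6*x4+15*x3+10*x2) - (x0+15*x4+10*x3)*(6*x2+15*(x1+10*x4)))
    + (x1+10*x4)*((6*x3+15*x2)*(6*x3+15*x2+10*(x1+10*x4)) -
    (6*x4+15*x3+10*x2)*(6*x2+15*(x1+10*x4)))) + (x1*(x1+10*x4) -
    x2*(x0+15*x4))*(6*x3*((x0+15*x4+10*x3)*(x0+15*x4+10*x3) - (x1+10*x4)*(6*x4+15*x3+10*x2)) -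
    (x1+10*x4)*(6*x2*(x0+15*x4+10*x3) - (x1+10*x4)*6*(x1+10*x4)) + x2*(6*x2*(6*x4+15*x3+10*x2)
    - (x0+15*x4+10*x3)*6*(x1+10*x4))) - (x1*x2 -
    x3*(x0+15*x4))*(6*x3*((6*x4+15*x3+10*x2)*(x0+15*x4+10*x3) -
    (x1+10*x4)*(6*x3+15*x2+10*(x1+10*x4))) - (x0+15*x4+10*x3)*(6*x2*(x0+15*x4+10*x3) -
    (x1+10*x4)*6*(x1+10*x4)) + x2*(6*x2*(6*x3+15*x2+10*(x1+10*x4)) -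
    (6*x4+15*x3+10*x2)*6*(x1+10*x4))) + (x1*x3 -
    x4*(x0+15*x4))*(6*x3*((6*x4+15*x3+10*x2)*(6*x4+15*x3+10*x2) -
    (x0+15*x4+10*x3)*(6*x3+15*x2+10*(x1+10*x4))) - (x0+15*x4+10*x3)*(6*x2*(6*x4+15*x3+10*x2) -
    (x0+15*x4+10*x3)*6*(x1+10*x4)) + (x1+10*x4)*(6*x2*(6*x3+15*x2+10*(x1+10*x4)) -
    (6*x4+15*x3+10*x2)*6*(x1+10*x4))) + (x2*x2 -
    x3*(x1+10*x4))*(6*x3*((6*x3+15*x2)*(x0+15*x4+10*x3) - (x1+10*x4)*(6*x2+15*(x1+10*x4))) -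
    (6*x4+15*x3)*(6*x2*(x0+15*x4+10*x3) - (x1+10*x4)*6*(x1+10*x4)) +
    x2*(6*x2*(6*x2+15*(x1+10*x4)) - (6*x3+15*x2)*6*(x1+10*x4))) - (x2*x3 -
    x4*(x1+10*x4))*(6*x3*((6*x3+15*x2)*(6*x4+15*x3+10*x2) -
    (x0+15*x4+10*x3)*(6*x2+15*(x1+10*x4))) - (6*x4+15*x3)*(6*x2*(6*x4+15*x3+10*x2) -
    (x0+15*x4+10*x3)*6*(x1+10*x4)) + (x1+10*x4)*(6*x2*(6*x2+15*(x1+10*x4)) -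
    (6*x3+15*x2)*6*(x1+10*x4))) + (x3*x3 -
    x4*x2)*(6*x3*((6*x3+15*x2)*(6*x3+15*x2+10*(x1+10*x4)) -
    (6*x4+15*x3+10*x2)*(6*x2+15*(x1+10*x4))) - (6*x4+15*x3)*(6*x2*(6*x3+15*x2+10*(x1+10*x4)) -
    (6*x4+15*x3+10*x2)*6*(x1+10*x4)) + (x0+15*x4+10*x3)*(6*x2*(6*x2+15*(x1+10*x4)) -
    (6*x3+15*x2)*6*(x1+10*x4)))

set_option maxHeartbeats 4000000 in
theorem det5 {R : Type*} [CommRing R] (a00 a01 a02 a03 a04 a10 a11 a12 a13 a14 a20 a21 a22 a23 a24 a30 a31 a32 a33 a34 a40 a41 a42 a43 a44 : R) :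
    Matrix.det !![a00, a01, a02, a03, a04; a10, a11, a12, a13, a14; a20, a21, a22, a23, a24; a30, a31, a32, a33, a34; a40, a41, a42, a43, a44] =
    (a00*(a11*(a22*(a33*a44 - a34*a43) - a23*(a32*a44 - a34*a42) + a24*(a32*a43 - a33*a42)) -
    a12*(a21*(a33*a44 - a34*a43) - a23*(a31*a44 - a34*a41) + a24*(a31*a43 - a33*a41)) +
    a13*(a21*(a32*a44 - a34*a42) - a22*(a31*a44 - a34*a41) + a24*(a31*a42 - a32*a41)) -
    a14*(a21*(a32*a43 - a33*a42) - a22*(a31*a43 - a33*a41) + a23*(a31*a42 - a32*a41))) -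
    a01*(a10*(a22*(a33*a44 - a34*a43) - a23*(a32*a44 - a34*a42) + a24*(a32*a43 - a33*a42)) -
    a12*(a20*(a33*a44 - a34*a43) - a23*(a30*a44 - a34*a40) + a24*(a30*a43 - a33*a40)) +
    a13*(a20*(a32*a44 - a34*a42) - a22*(a30*a44 - a34*a40) + a24*(a30*a42 - a32*a40)) -
    a14*(a20*(a32*a43 - a33*a42) - a22*(a30*a43 - a33*a40) + a23*(a30*a42 - a32*a40))) +
    a02*(a10*(a21*(a33*a44 - a34*a43) - a23*(a31*a44 - a34*a41) + a24*(a31*a43 - a33*a41)) -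
    a11*(a20*(a33*a44 - a34*a43) - a23*(a30*a44 - a34*a40) + a24*(a30*a43 - a33*a40)) +
    a13*(a20*(a31*a44 - a34*a41) - a21*(a30*a44 - a34*a40) + a24*(a30*a41 - a31*a40)) -
    a14*(a20*(a31*a43 - a33*a41) - a21*(a30*a43 - a33*a40) + a23*(a30*a41 - a31*a40))) -
    a03*(a10*(a21*(a32*a44 - a34*a42) - a22*(a31*a44 - a34*a41) + a24*(a31*a42 - a32*a41)) -
    a11*(a20*(a32*a44 - a34*a42) - a22*(a30*a44 - a34*a40) + a24*(a30*a42 - a32*a40)) +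
    a12*(a20*(a31*a44 - a34*a41) - a21*(a30*a44 - a34*a40) + a24*(a30*a41 - a31*a40)) -
    a14*(a20*(a31*a42 - a32*a41) - a21*(a30*a42 - a32*a40) + a22*(a30*a41 - a31*a40))) +
    a04*(a10*(a21*(a32*a43 - a33*a42) - a22*(a31*a43 - a33*a41) + a23*(a31*a42 - a32*a41)) -
    a11*(a20*(a32*a43 - a33*a42) - a22*(a30*a43 - a33*a40) + a23*(a30*a42 - a32*a40)) +
    a12*(a20*(a31*a43 - a33*a41) - a21*(a30*a43 - a33*a40) + a23*(a30*a41 - a31*a40)) -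
    a13*(a20*(a31*a42 - a32*a41) - a21*(a30*a42 - a32*a40) + a22*(a30*a41 - a31*a40)))) := by
  simp [Matrix.det_succ_row_zero, Fin.sum_univ_succ, Fin.succAbove]
  ring

set_option maxHeartbeats 4000000 in
theorem N5_det {R : Type*} [CommRing R] (x0 x1 x2 x3 x4 : R) :
    Matrix.det !![x0, x1, x2, x3, x4; 6*x4, (x0+15*x4), (x1+10*x4), x2, x3; 6*x3, (6*x4+15*x3), (x0+15*x4+10*x3), (x1+10*x4), x2; 6*x2, (6*x3+15*x2), (6*x4+15*x3+10*x2), (x0+15*x4+10*x3), (x1+10*x4); 6*(x1+10*x4), (6*x2+15*(x1+10*x4)), (6*x3+15*x2+10*(x1+10*x4)), (6*x4+15*x3+10*x2), (x0+15*x4+10*x3)] = N5 x0 x1 x2 x3 x4 := by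
  rw [det5]; simp only [N5]; ring

end C38

namespace C38

open NumberField

/-- The defining polynomial of the quintic field. -/
noncomputable def polZ : Polynomial ℤ :=
  Polynomial.X ^ 5 - 10 * Polynomial.X ^ 2 - 15 * Polynomial.X - 6

noncomputable def pol : Polynomial ℚ :=
  Polynomial.X ^ 5 - 10 * Polynomial.X ^ 2 - 15 * Polynomial.X - 6

noncomputable def polE : Polynomial ℤ :=
  Polynomial.X ^ 5 + (5 * Polynomial.X ^ 4 + 10 * Polynomial.X ^ 3 - 30 * Polynomial.X - 30)

theorem polE_monic : polE.Monic := by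
  unfold polE; monicity!

theorem polE_natDegree : polE.natDegree = 5 := by
  unfold polE; compute_degree!

theorem polZ_monic : polZ.Monic := by
  unfold polZ; monicity!

theorem polE_irreducible : Irreducible polE := by
  have hp : (Ideal.span {(5 : ℤ)}).IsPrime := by
    rw [Ideal.span_singleton_prime (by norm_num)]
    norm_num
  refine Polynomial.irreducible_of_eisenstein_criterion hp ?_ ?_ ?_ ?_ polE_monic.isPrimitive
  · rw [polE_monic.leadingCoeff, Ideal.mem_span_singleton]; norm_num
  · intro n hn
    rw [Polynomial.degree_eq_natDegree polE_monic.ne_zero, polE_natDegree] at hn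
    have hn' : n < 5 := by exact_mod_cast hn
    rw [Ideal.mem_span_singleton]
    interval_cases n <;>
      simp [polE, Polynomial.coeff_X, Polynomial.coeff_X_pow,
        Polynomial.coeff_ofNat_mul]
  · rw [Polynomial.degree_eq_natDegree polE_monic.ne_zero, polE_natDegree]; norm_num
  · rw [Ideal.span_singleton_pow, Ideal.mem_span_singleton]
    simp [polE]

theorem polZ_irreducible : Irreducible polZ := by
  have h : Polynomial.algEquivAevalXAddC (1 : ℤ) polZ = polE := by
    have e : ∀ q : Polynomial ℤ, Polynomial.algEquivAevalXAddC (1 : ℤ) q =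
        Polynomial.aeval (Polynomial.X + 1) q := by
      intro q; simp [Polynomial.algEquivAevalXAddC]
    rw [e]
    simp only [polZ, polE, map_sub, map_pow, map_mul, Polynomial.aeval_X,
      map_ofNat (Polynomial.aeval (R := ℤ) (Polynomial.X + 1 : Polynomial ℤ))]
    ring
  rw [← MulEquiv.irreducible_iff (Polynomial.algEquivAevalXAddC (1 : ℤ))] 
  rw [h]; exact polE_irreducible

theorem polZ_map : polZ.map (Int.castRingHom ℚ) = pol := by
  simp [polZ, pol]

theorem pol_irreducible : Irreducible pol := by
  rw [← polZ_map]
  exact (polZ_monic.irreducible_iff_irreducible_map_fraction_map).1 polZ_irreducible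

theorem pol_monic : pol.Monic := by
  unfold pol; monicity!

theorem pol_natDegree : pol.natDegree = 5 := by
  unfold pol; compute_degree!

/-- The quintic field. -/
def K : Type := AdjoinRoot pol

noncomputable instance : Field K :=
  haveI : Fact (Irreducible pol) := ⟨pol_irreducible⟩
  inferInstanceAs (Field (AdjoinRoot pol))

instance : CharZero K :=
  haveI : Fact (Irreducible pol) := ⟨pol_irreducible⟩
  inferInstanceAs (CharZero (AdjoinRoot pol))

noncomputable def eqvK : AdjoinRoot pol ≃ₐ[ℚ] K :=
  AlgEquiv.ofRingEquiv (f := (RingEquiv.refl (AdjoinRoot pol) : AdjoinRoot pol ≃+* K))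
    (fun q => RingHom.congr_fun (Subsingleton.elim
      ((RingEquiv.refl (AdjoinRoot pol) : AdjoinRoot pol ≃+* K).toRingHom.comp
        (algebraMap ℚ (AdjoinRoot pol))) (algebraMap ℚ K)) q)

noncomputable def pb0 : PowerBasis ℚ (AdjoinRoot pol) :=
  AdjoinRoot.powerBasis pol_monic.ne_zero

noncomputable def pb : PowerBasis ℚ K := pb0.map eqvK

theorem pb_dim : pb.dim = 5 := by
  simp [pb, pb0, pol_natDegree]

instance : FiniteDimensional ℚ K := pb.finite

instance : NumberField K where
  to_charZero := inferInstance
  to_finiteDimensional := inferInstance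

theorem finrank_K : Module.finrank ℚ K = 5 := by
  rw [pb.finrank, pb_dim]

noncomputable def tK : K := pb.gen

theorem minpoly_tK : minpoly ℚ pb.gen = pol := by
  rw [pb, PowerBasis.map_gen, minpoly.algEquiv_eq, pb0, AdjoinRoot.powerBasis_gen,
    AdjoinRoot.minpoly_root pol_monic.ne_zero, pol_monic.leadingCoeff]
  simp

theorem tK_eq : tK ^ 5 = 10 * tK ^ 2 + 15 * tK + 6 := by
  have h : Polynomial.aeval tK pol = 0 := by
    rw [← minpoly_tK]; exact minpoly.aeval _ _
  simp only [pol, map_sub, map_pow, map_mul, Polynomial.aeval_X,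
    map_ofNat (Polynomial.aeval (R := ℚ) tK)] at h
  linear_combination h

theorem tK_integral : IsIntegral ℤ tK := by
  refine ⟨polZ, polZ_monic, ?_⟩
  simp only [polZ, Polynomial.eval₂_sub, Polynomial.eval₂_mul, Polynomial.eval₂_pow,
    Polynomial.eval₂_X, Polynomial.eval₂_ofNat]
  linear_combination tK_eq

/-- The generator of the quintic field, as an algebraic integer. -/
noncomputable def th : 𝓞 K := ⟨tK, tK_integral⟩

theorem th_eq : th ^ 5 = 10 * th ^ 2 + 15 * th + 6 := by
  apply FaithfulSMul.algebraMap_injective (𝓞 K) K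
  have e : ∀ n : ℕ, (algebraMap (𝓞 K) K (OfNat.ofNat (n + 2))) = OfNat.ofNat (n + 2) := fun n =>
    map_ofNat (algebraMap (𝓞 K) K) (n + 2)
  have h : algebraMap (𝓞 K) K th = tK := rfl
  rw [map_add, map_add, map_mul, map_mul, map_pow, map_pow, h, tK_eq]
  exact congrArg₂ _ (congrArg₂ _ (congrArg₂ _ (e 8).symm rfl) (congrArg₂ _ (e 13).symm rfl)) (e 4).symm

noncomputable def bs : Module.Basis (Fin 5) ℚ K := pb.basis.reindex (finCongr pb_dim)

theorem bs_apply (i : Fin 5) : bs i = tK ^ (i : ℕ) := by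
  simp [bs, tK]

theorem norm_K (x0 x1 x2 x3 x4 : ℚ) :
    Algebra.norm ℚ ((x0 : K) + x1 * tK + x2 * tK ^ 2 + x3 * tK ^ 3 + x4 * tK ^ 4) =
      N5 x0 x1 x2 x3 x4 := by
  rw [Algebra.norm_eq_matrix_det bs, ← N5_det, ← Matrix.det_transpose]
  congr 1
  have key : ∀ (j : Fin 5) (x : K) (c : Fin 5 → ℚ), x * bs j = ∑ i, c i • bs i →
      ∀ i, Algebra.leftMulMatrix bs x i j = c i := by
    intro j x c h i
    rw [Algebra.leftMulMatrix_eq_repr_mul, h, Module.Basis.repr_sum_self]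
  ext i j
  rw [Matrix.transpose_apply]
  have h := tK_eq
  have e := key i ((x0 : K) + x1 * tK + x2 * tK ^ 2 + x3 * tK ^ 3 + x4 * tK ^ 4)
    (!![x0, x1, x2, x3, x4; 6*x4, (x0+15*x4), (x1+10*x4), x2, x3;
      6*x3, (6*x4+15*x3), (x0+15*x4+10*x3), (x1+10*x4), x2;
      6*x2, (6*x3+15*x2), (6*x4+15*x3+10*x2), (x0+15*x4+10*x3), (x1+10*x4);
      6*(x1+10*x4), (6*x2+15*(x1+10*x4)), (6*x3+15*x2+10*(x1+10*x4)),
      (6*x4+15*x3+10*x2), (x0+15*x4+10*x3)] i) ?_ j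
  · exact e
  · simp only [bs_apply, Fin.sum_univ_five, Algebra.smul_def, eq_ratCast]
    fin_cases i <;> simp
    · linear_combination ((x4 : K)) * h
    · linear_combination ((x3 : K) + x4 * tK) * h
    · linear_combination ((x2 : K) + x3 * tK + x4 * tK ^ 2) * h
    · linear_combination ((x1 : K) + x2 * tK + x3 * tK ^ 2 + x4 * (tK ^ 3 + 10)) * h

theorem norm_Z (x0 x1 x2 x3 x4 : ℤ) :
    Algebra.norm ℤ ((x0 : 𝓞 K) + x1 * th + x2 * th ^ 2 + x3 * th ^ 3 + x4 * th ^ 4) =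
      N5 x0 x1 x2 x3 x4 := by
  have h := norm_K x0 x1 x2 x3 x4
  have h2 := Algebra.coe_norm_int
    ((x0 : 𝓞 K) + (x1 : 𝓞 K) * th + (x2 : 𝓞 K) * th ^ 2 + (x3 : 𝓞 K) * th ^ 3 + (x4 : 𝓞 K) * th ^ 4)
  have h3 : (N5 (x0 : ℚ) x1 x2 x3 x4) = ((N5 x0 x1 x2 x3 x4 : ℤ) : ℚ) := by
    simp only [N5]; push_cast; ring
  rw [h3] at h
  rw [← @Int.cast_inj ℚ, h2, ← h]
  congr 1

theorem discr_bs : Algebra.discr ℚ bs = 16200000 := by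
  have h : Algebra.discr ℚ bs = Algebra.discr ℚ pb.basis := by
    rw [bs, Module.Basis.coe_reindex, Algebra.discr_reindex]
  rw [h, Algebra.discr_powerBasis_eq_norm, minpoly_tK, finrank_K]
  have e : Polynomial.aeval pb.gen (Polynomial.derivative pol) =
      ((-15 : ℚ) : K) + (-20 : ℚ) * tK + (0 : ℚ) * tK ^ 2 + (0 : ℚ) * tK ^ 3 + (5 : ℚ) * tK ^ 4 := by
    have : pb.gen = tK := rfl
    rw [this]
    have e2 : Polynomial.derivative pol = 5 * Polynomial.X ^ 4 - 20 * Polynomial.X - 15 := by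
      have e4 : (Polynomial.C 4 : Polynomial ℚ) = 4 := map_ofNat Polynomial.C 4
      simp [pol, e4]; ring
    simp only [e2, map_sub, map_pow, map_mul, Polynomial.aeval_X,
      map_ofNat (Polynomial.aeval (R := ℚ) tK)]
    push_cast
    ring
  rw [e, norm_K]
  norm_num [N5]

theorem discr_le : |discr K| ≤ 16200000 := by
  have hd : discr K ≠ 0 := discr_ne_zero K
  let e : Fin 5 ≃ Module.Free.ChooseBasisIndex ℤ (𝓞 K) :=
    (Module.Basis.indexEquiv bs (integralBasis K))
  let b' : Module.Basis (Fin 5) ℚ K := (integralBasis K).reindex e.symm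
  have h1 : Algebra.discr ℚ b' = discr K := by
    rw [coe_discr]
    simp only [b', Module.Basis.coe_reindex]
    rw [Algebra.discr_reindex]
  have h2 : Algebra.discr ℚ bs = (b'.toMatrix bs).det ^ 2 * Algebra.discr ℚ b' := by
    rw [← Algebra.discr_of_matrix_vecMul, Module.Basis.toMatrix_map_vecMul]
  have h3 : IsIntegral ℤ (b'.toMatrix bs).det := by
    refine IsIntegral.det fun i j => ?_
    rw [Module.Basis.toMatrix_apply]
    simp only [b', Module.Basis.repr_reindex_apply]
    have : bs j = algebraMap (𝓞 K) K (th ^ (j : ℕ)) := by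
      rw [bs_apply, map_pow]; rfl
    rw [this, integralBasis_repr_apply]
    exact isIntegral_algebraMap
  obtain ⟨z, hz⟩ := IsIntegrallyClosed.isIntegral_iff.1 h3
  rw [h1, discr_bs, ← hz] at h2
  have h4 : (16200000 : ℤ) = z ^ 2 * discr K := by
    have : ((16200000 : ℤ) : ℚ) = ((z ^ 2 * discr K : ℤ) : ℚ) := by
      push_cast; simpa using h2
    exact_mod_cast this
  have hdiv : discr K ∣ 16200000 := ⟨z ^ 2, by linarith⟩
  have := Int.le_of_dvd (by norm_num) ((abs_dvd _ _).2 hdiv)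
  exact this

open InfinitePlace

theorem real_root_unique {x y : ℝ} (hx : x ^ 5 = 10 * x ^ 2 + 15 * x + 6)
    (hy : y ^ 5 = 10 * y ^ 2 + 15 * y + 6) : x = y := by
  have pos : ∀ z : ℝ, z ^ 5 = 10 * z ^ 2 + 15 * z + 6 → 0 < z := by
    intro z hz
    have h : 0 < z ^ 5 := by rw [hz]; nlinarith [sq_nonneg (4 * z + 3)]
    by_contra hc
    have : z ^ 5 ≤ 0 := Odd.pow_nonpos (by decide) (not_lt.1 hc)
    linarith
  have px := pos x hx
  have py := pos y hy
  have key : (x - y) * (10 * x ^ 2 * y ^ 2 * (x ^ 2 + x * y + y ^ 2) +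
      15 * x * y * (x + y) * (x ^ 2 + y ^ 2) +
      6 * (x ^ 4 + x ^ 3 * y + x ^ 2 * y ^ 2 + x * y ^ 3 + y ^ 4)) = 0 := by
    linear_combination (y ^ 5) * hx - x ^ 5 * hy
  rcases mul_eq_zero.1 key with h | h
  · linarith
  · have : 0 < (10 * x ^ 2 * y ^ 2 * (x ^ 2 + x * y + y ^ 2) +
      15 * x * y * (x + y) * (x ^ 2 + y ^ 2) +
      6 * (x ^ 4 + x ^ 3 * y + x ^ 2 * y ^ 2 + x * y ^ 3 + y ^ 4)) := by positivity
    linarith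

theorem nrReal_le : nrRealPlaces K ≤ 1 := by
  classical
  rw [← card_real_embeddings, Fintype.card_le_one_iff_subsingleton]
  refine ⟨fun ⟨φ, hφ⟩ ⟨ψ, hψ⟩ => ?_⟩
  have e : ∀ (χ : K →+* ℂ) (h : ComplexEmbedding.IsReal χ),
      (h.embedding tK) ^ 5 = 10 * (h.embedding tK) ^ 2 + 15 * (h.embedding tK) + 6 := by
    intro χ h
    have := congrArg h.embedding tK_eq
    rwa [map_add, map_add, map_mul, map_mul, map_pow, map_pow, map_ofNat, map_ofNat,
      map_ofNat] at this
  have h := real_root_unique (e φ hφ) (e ψ hψ)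
  have h' : φ tK = ψ tK := by
    rw [← hφ.coe_embedding_apply, ← hψ.coe_embedding_apply, h]
  have : φ.toRatAlgHom = ψ.toRatAlgHom := pb.algHom_ext h'
  have h2 : φ = ψ := RingHom.ext fun x => DFunLike.congr_fun this x
  exact Subtype.ext h2

theorem nrComplex_eq : nrComplexPlaces K = 2 ∧ nrRealPlaces K = 1 := by
  have h := card_add_two_mul_card_eq_rank K
  rw [finrank_K] at h
  have := nrReal_le
  omega

end C38

namespace C38

open NumberField

/-- Generators of the prime ideals of degree one and norm at most 250. -/
def tab : List (ℕ × ℕ × ℤ × ℤ × ℤ × ℤ × ℤ) :=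
    [(2,0,-2,-12,1,-1,1), (2,1,1,1,0,0,0), (3,0,-3,-8,-7,-3,-2), (3,1,-229,19,-59,21,5),
    (5,1,839,1977,-591,-21,-39), (7,4,5,14,8,-3,-1), (11,2,-49,-135,-126,-58,-33),
    (11,5,1291,2590,292,-1088,196), (17,3,35,58,19,-3,-6), (19,4,-451,-348,5,-9,34),
    (19,14,4603,11835,8338,-1723,-1412), (23,9,-131,-167,194,265,-48),
    (29,13,2863,2823,-145,67,-239), (29,24,-1,-1,1,0,0), (31,23,-85,-188,-55,97,22),
    (37,7,53,78,15,-67,18), (53,23,-1,-5,-3,2,0), (61,6,-25,-38,-1,0,3),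
    (61,55,-175,-336,-174,58,28), (67,39,53,141,68,-41,-4), (73,7,-43,-55,39,29,-13),
    (73,37,-1,-4,-5,-2,-1), (73,61,91,368,113,-203,38), (89,47,-1129,-6334,-3692,1360,436),
    (101,15,1423,4013,3598,1059,388), (101,63,25,53,2,5,-6), (103,23,5,15,15,6,2),
    (103,59,3463,3311,432,-156,-283), (103,71,-145,-204,41,-30,21), (113,109,73,77,-19,-1,-3),
    (127,5,1439,2465,-14,-244,-83), (131,30,-5,-10,-7,2,1), (167,68,827,1216,-65,67,-108),
    (179,87,-43,-6,-17,5,2), (179,171,-365,-998,-329,1131,860),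
    (181,127,-1651,-2885,1339,2084,-808), (181,172,-11,-8,30,28,-8), (191,55,25,69,62,23,12),
    (191,162,-5,-36,1,31,-10), (193,13,7,-156,-329,-122,107), (193,20,961,265,-123,22,-28),
    (193,59,-1667,-3834,-1481,1584,401), (197,27,7,9,2,0,-1), (199,46,1,9,12,-1,-2),
    (211,58,1439,4214,4076,1437,445), (223,80,11,16,-9,-13,8), (227,65,-5,-8,0,-1,1),
    (239,43,-4475,-3734,-655,112,383), (239,78,83,163,88,-13,-20)]

def primesL : List ℕ :=
    [2, 3, 5, 7, 11, 13, 17, 19, 23, 29, 31, 37, 41, 43, 47, 53, 59, 61, 67, 71, 73, 79, 83,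
    89, 97, 101, 103, 107, 109, 113, 127, 131, 137, 139, 149, 151, 157, 163, 167, 173, 179,
    181, 191, 193, 197, 199, 211, 223, 227, 229, 233, 239, 241]

def okEntry (p r : ℕ) (e : ℕ × ℕ × ℤ × ℤ × ℤ × ℤ × ℤ) : Bool :=
  match e with
  | (q, s, a, b, c, d, f) => q == p && (s == r && (((a + b * r + c * r ^ 2 + d * r ^ 3 + f * r ^ 4) % p == 0)
      && ((N5 a b c d f).natAbs == p)))

def okPair (p r : ℕ) : Bool :=
  (r ^ 5 % p != (10 * r ^ 2 + 15 * r + 6) % p) || tab.any (okEntry p r)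

theorem okAll : (primesL.all fun p => (List.range p).all fun r => okPair p r) = true := by
  decide +kernel

theorem primesL_mem : ∀ p < 251, p.Prime → p ∈ primesL := by
  decide +kernel

theorem excl7 {F : Type*} [CommRing F] (t : F) (hp : (7 : F) = 0)
    (hQ : -2 - 2*t + 2*t^2 - 3*t^3 + 1*t^4 = 0) (hq : t ^ 49 = t) : (1 : F) = 0 := by
  have h1 : t ^ 7 = -1 - 1*t + 3*t^3 := by
    linear_combination (17 + 7*t + 3*t^2 + 1*t^3) * hQ + (5 + 7*t - 2*t^2 + 6*t^3) * hp
  have h2 : (-1 - 1*t + 3*t^3) ^ 7 = -1*t^2 + 1*t^3 := by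
    linear_combination
      (18677648896 + 7079806499*t + 2683498493*t^2 + 1017081335*t^3 + 385531812*t^4 +
      146204886*t^5 + 55454058*t^6 + 20994093*t^7 + 7919424*t^8 + 2996487*t^9 +
      1157409*t^10 + 454248*t^11 + 167670*t^12 + 52488*t^13 + 16767*t^14 + 10206*t^15 +
      6561*t^16 + 2187*t^17) * hQ + (5336471113 + 7359272969*t - 2546955404*t^2 +
      7039213333*t^3) * hp
  have h3 : t = -1*t^2 + 1*t^3 := by
    rw [← h2, ← h1, ← pow_mul]; exact hq.symm
  linear_combination (3 + 3*t + 2*t^2) * hQ + (-2 - 1*t - 1*t^2 + 2*t^3) * h3 + (1 + 2*t + 1*t^2 + 1*t^3) * hp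

theorem excl11 {F : Type*} [CommRing F] (t : F) (hp : (11 : F) = 0)
    (hQ : -5 - 5*t - 4*t^2 + 1*t^3 = 0) (hq : t ^ 121 = t) : (1 : F) = 0 := by
  have h1 : t ^ 11 = -2 + 3*t + 5*t^2 := by
    linear_combination (397016 + 76979*t + 14926*t^2 + 2894*t^3 + 561*t^4 + 109*t^5 + 21*t^6 + 4*t^7 + 1*t^8) * hQ + (180462 + 215452*t + 186144*t^2) * hp
  have h2 : (-2 + 3*t + 5*t^2) ^ 11 = -5 - 4*t - 5*t^2 := by
    linear_combination
      (3847836565747996979900 + 746073886014442370750*t + 144659533709775649555*t^2 +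
      28048670628269790689*t^3 + 5438479606797848425*t^4 + 1054490632542673050*t^5 +
      204459807673535615*t^6 + 39643607643896430*t^7 + 7686672729162752*t^8 +
      1490402722080695*t^9 + 288980602136625*t^10 + 56031675405000*t^11 +
      10864440381250*t^12 + 2106537556250*t^13 + 408192828125*t^14 + 79152734375*t^15 +
      15548828125*t^16 + 3066406250*t^17 + 517578125*t^18 + 48828125*t^19) * hQ +
      (1749016620794544081587 + 2088141114437472435186*t + 1804092123783007074910*t^2) *
      hp
  have h3 : t = -5 - 4*t - 5*t^2 := by
    rw [← h2, ← h1, ← pow_mul]; exact hq.symm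
  linear_combination (1 + 1*t) * hQ + (-1 + 3*t + 2*t^2) * h3 + (1 - 1*t^2 - 2*t^3 - 1*t^4) * hp

theorem excl13 {F : Type*} [CommRing F] (t : F) (hp : (13 : F) = 0)
    (hQ : 1 + 2*t + 3*t^2 + 1*t^3 = 0) (hq : t ^ 169 = t) : (1 : F) = 0 := by
  have h1 : t ^ 13 = -5 - 6*t + 4*t^2 := by
    linear_combination (5842 - 2513*t + 1081*t^2 - 465*t^3 + 200*t^4 - 86*t^5 + 37*t^6 - 16*t^7 + 7*t^8 - 3*t^9 + 1*t^10) * hQ + (-449 - 705*t - 1045*t^2) * hp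
  have h2 : (-5 - 6*t + 4*t^2) ^ 13 = 2 + 5*t - 4*t^2 := by
    linear_combination
      (-2050071884718959680 + 881858274593748656*t - 379339957549306656*t^2 +
      163176555567577024*t^3 - 70192177299732736*t^4 + 30194758058541056*t^5 -
      12987411230460928*t^6 + 5585009581031424*t^7 - 2404745042821120*t^8 +
      1036547481808896*t^9 - 443255280377856*t^10 + 188397897170944*t^11 -
      82875565408256*t^12 + 37614671626240*t^13 - 15562039885824*t^14 +
      5497863274496*t^15 - 2238716051456*t^16 + 1364724809728*t^17 - 789772763136*t^18 +
      322822995968*t^19 - 87442849792*t^20 + 15082717184*t^21 - 1509949440*t^22 +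
      67108864*t^23) * hQ + (157697837192173581 + 247560421215477073*t +
      366602995238817376*t^2) * hp
  have h3 : t = 2 + 5*t - 4*t^2 := by
    rw [← h2, ← h1, ← pow_mul]; exact hq.symm
  linear_combination (-4) * hQ + (4 + 1*t) * h3 + (1 + 2*t) * hp

theorem linFactor {F : Type*} [Field F] (t : F) (h : t ^ 5 = 10 * t ^ 2 + 15 * t + 6)
    (p q : ℕ) (hp : p.Prime) (hpF : (p : F) = 0) (hq : q = p ^ 2 ∨ p < 7) (hle : p ≤ 15)
    (ht : t ^ q = t) : (∃ r : ℕ, r < p ∧ t = r) ∨ (p = 13 ∧ -6 - 3*t + 1*t^2 = 0) := by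
  have key : p = 2 ∨ p = 3 ∨ p = 5 ∨ p = 7 ∨ p = 11 ∨ p = 13 := by
    interval_cases p <;> first | omega | (exfalso; revert hp; norm_num)
  rcases key with rfl | rfl | rfl | rfl | rfl | rfl
  · left
    have hp' : (2 : F) = 0 := by exact_mod_cast hpF
    have e : t * (t - 1) ^ 4 = 0 := by linear_combination h + (3 + 8*t + 3*t^2 + 3*t^3 - 2*t^4) * hp'
    rcases mul_eq_zero.1 e with e | e
    · exact ⟨0, by norm_num, by simpa using e⟩
    · exact ⟨1, by norm_num, by simpa using sub_eq_zero.1 (pow_eq_zero_iff (by norm_num) |>.1 e)⟩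
  · left
    have hp' : (3 : F) = 0 := by exact_mod_cast hpF
    have e : t ^ 2 * (t - 1) ^ 3 = 0 := by linear_combination h + (2 + 5*t + 3*t^2 + 1*t^3 - 1*t^4) * hp'
    rcases mul_eq_zero.1 e with e | e
    · exact ⟨0, by norm_num, by simpa using e⟩
    · exact ⟨1, by norm_num, by simpa using sub_eq_zero.1 (pow_eq_zero_iff (by norm_num) |>.1 e)⟩
  · left
    have hp' : (5 : F) = 0 := by exact_mod_cast hpF
    have e : (t - 1) ^ 5 = 0 := by linear_combination h + (1 + 4*t + 2*t^3 - 1*t^4) * hp'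
    exact ⟨1, by norm_num, by simpa using sub_eq_zero.1 (pow_eq_zero_iff (by norm_num) |>.1 e)⟩
  · left
    have hp' : (7 : F) = 0 := by exact_mod_cast hpF
    have hq' : q = 49 := by omega
    subst hq'
    have e : (t - 4) * (-2 - 2*t + 2*t^2 - 3*t^3 + 1*t^4) = 0 := by linear_combination h + (2 + 3*t + 2*t^3 - 1*t^4) * hp'
    rcases mul_eq_zero.1 e with e | e
    · exact ⟨4, by norm_num, by simpa using sub_eq_zero.1 e⟩
    · exact absurd (excl7 t hp' e ht) one_ne_zero
  · left
    have hp' : (11 : F) = 0 := by exact_mod_cast hpF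
    have hq' : q = 121 := by omega
    subst hq'
    have e : (t - 2) * (t - 5) * (-5 - 5*t - 4*t^2 + 1*t^3) = 0 := by linear_combination h + (-4 + 3*t^3 - 1*t^4) * hp'
    rcases mul_eq_zero.1 e with e | e
    · rcases mul_eq_zero.1 e with e | e
      · exact ⟨2, by norm_num, by simpa using sub_eq_zero.1 e⟩
      · exact ⟨5, by norm_num, by simpa using sub_eq_zero.1 e⟩
    · exact absurd (excl11 t hp' e ht) one_ne_zero
  · right
    have hp' : (13 : F) = 0 := by exact_mod_cast hpF
    have hq' : q = 169 := by omega
    subst hq'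
    have e : (-6 - 3*t + 1*t^2) * (1 + 2*t + 3*t^2 + 1*t^3) = 0 := by linear_combination h + (-1*t^2 - 1*t^3) * hp'
    rcases mul_eq_zero.1 e with e | e
    · exact ⟨rfl, e⟩
    · exact absurd (excl13 t hp' e ht) one_ne_zero

theorem principal_of_norm_eq (P : Ideal (𝓞 K)) (x0 x1 x2 x3 x4 : ℤ)
    (hx : (x0 : 𝓞 K) + x1 * th + x2 * th ^ 2 + x3 * th ^ 3 + x4 * th ^ 4 ∈ P)
    (hN : (N5 x0 x1 x2 x3 x4).natAbs = Ideal.absNorm P) (h0 : Ideal.absNorm P ≠ 0) :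
    Submodule.IsPrincipal P := by
  set g : 𝓞 K := (x0 : 𝓞 K) + x1 * th + x2 * th ^ 2 + x3 * th ^ 3 + x4 * th ^ 4 with hg
  have h1 : Ideal.absNorm (Ideal.span {g}) = Ideal.absNorm P := by
    rw [Ideal.absNorm_span_singleton, hg, norm_Z, hN]
  have h2 : P ∣ Ideal.span {g} := by
    rw [Ideal.dvd_iff_le, Ideal.span_singleton_le_iff_mem]; exact hx
  obtain ⟨J, hJ⟩ := h2
  rw [hJ, map_mul] at h1
  have h3 : Ideal.absNorm J = 1 := by
    exact Nat.eq_of_mul_eq_mul_left (Nat.pos_of_ne_zero h0) (by rw [h1, mul_one])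
  rw [Ideal.absNorm_eq_one_iff] at h3
  rw [h3, Ideal.mul_top] at hJ
  exact ⟨⟨g, hJ.symm⟩⟩

theorem principal_of_root (P : Ideal (𝓞 K)) (hP : P.IsPrime) (p r : ℕ) (hp : p.Prime)
    (hpP : (p : 𝓞 K) ∈ P) (hr : r < p) (hp250 : p ≤ 250) (ht : th - (r : 𝓞 K) ∈ P) :
    Submodule.IsPrincipal P := by
  have hpi : ∀ z : ℤ, (z : 𝓞 K) ∈ P → (p : ℤ) ∣ z := by
    intro z hz
    by_contra hnd
    have hco : IsCoprime (p : ℤ) z :=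
      (Prime.coprime_iff_not_dvd (Nat.prime_iff_prime_int.1 hp)).2 hnd
    obtain ⟨a, b, hab⟩ := hco
    apply hP.ne_top
    rw [Ideal.eq_top_iff_one]
    have : (1 : 𝓞 K) = (a : 𝓞 K) * (p : 𝓞 K) + (b : 𝓞 K) * (z : 𝓞 K) := by
      have := congrArg (Int.cast : ℤ → 𝓞 K) hab
      push_cast at this
      exact this.symm
    rw [this]
    exact P.add_mem (P.mul_mem_left _ hpP) (P.mul_mem_left _ hz)
  have hroot : (p : ℤ) ∣ (r : ℤ) ^ 5 - (10 * (r : ℤ) ^ 2 + 15 * r + 6) := by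
    apply hpi
    have e : (((r : ℤ) ^ 5 - (10 * (r : ℤ) ^ 2 + 15 * r + 6) : ℤ) : 𝓞 K) =
        -(th ^ 4 + th ^ 3 * r + th ^ 2 * r ^ 2 + th * r ^ 3 + r ^ 4 - 10 * (th + r) - 15) *
          (th - (r : 𝓞 K)) := by
      push_cast
      linear_combination th_eq
    rw [e]
    exact P.mul_mem_left _ ht
  have hmod : r ^ 5 % p = (10 * r ^ 2 + 15 * r + 6) % p := by
    have h : ((r ^ 5 : ℕ) : ℤ) ≡ ((10 * r ^ 2 + 15 * r + 6 : ℕ) : ℤ) [ZMOD p] := by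
      push_cast
      exact (Int.modEq_iff_dvd.2 hroot).symm
    exact (Int.natCast_modEq_iff.1 h)
  have hok := okAll
  rw [List.all_eq_true] at hok
  have h1 := hok p (primesL_mem p (by omega) hp)
  rw [List.all_eq_true] at h1
  have h2 := h1 r (List.mem_range.2 hr)
  rw [okPair, Bool.or_eq_true] at h2
  rcases h2 with h2 | h2
  · rw [bne_iff_ne] at h2
    exact absurd hmod h2
  rw [List.any_eq_true] at h2
  obtain ⟨⟨q, s, a, b, c, d, f⟩, -, he⟩ := h2
  simp only [okEntry, Bool.and_eq_true, beq_iff_eq] at he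
  obtain ⟨-, -, h3, h4⟩ := he
  have hgP : (a : 𝓞 K) + b * th + c * th ^ 2 + d * th ^ 3 + f * th ^ 4 ∈ P := by
    obtain ⟨k, hk⟩ := Int.dvd_of_emod_eq_zero h3
    have hk' : (a : 𝓞 K) + b * r + c * r ^ 2 + d * r ^ 3 + f * r ^ 4 = p * k := by
      exact_mod_cast congrArg (Int.cast : ℤ → 𝓞 K) hk
    have e : (a : 𝓞 K) + b * th + c * th ^ 2 + d * th ^ 3 + f * th ^ 4 =
        k * p + (b + c * (th + r) + d * (th ^ 2 + th * r + r ^ 2) +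
          f * (th ^ 3 + th ^ 2 * r + th * r ^ 2 + r ^ 3)) * (th - r) := by
      linear_combination hk'
    rw [e]
    exact P.add_mem (P.mul_mem_left _ hpP) (P.mul_mem_left _ ht)
  have hpr : (Ideal.span {(a : 𝓞 K) + b * th + c * th ^ 2 + d * th ^ 3 + f * th ^ 4}).IsPrime := by
    apply Ideal.isPrime_of_irreducible_absNorm
    rw [Ideal.absNorm_span_singleton, norm_Z, h4]
    exact hp
  have hne : Ideal.span {(a : 𝓞 K) + b * th + c * th ^ 2 + d * th ^ 3 + f * th ^ 4} ≠ ⊥ := by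
    intro h
    have := congrArg Ideal.absNorm h
    rw [Ideal.absNorm_span_singleton, norm_Z, h4, Ideal.absNorm_bot] at this
    exact hp.ne_zero this
  have hmax := hpr.isMaximal hne
  have := hmax.eq_of_le hP.ne_top ((Ideal.span_singleton_le_iff_mem P).2 hgP)
  exact ⟨⟨_, this.symm⟩⟩

theorem principal_small (P : Ideal (𝓞 K)) (hP : P.IsPrime) (h0 : P ≠ ⊥)
    (hN : Ideal.absNorm P ≤ 250) : Submodule.IsPrincipal P := by
  have hmax : P.IsMaximal := hP.isMaximal h0
  let _ : Field (𝓞 K ⧸ P) := Ideal.Quotient.field P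
  have : Finite (𝓞 K ⧸ P) := Ideal.finiteQuotientOfFreeOfNeBot P h0
  let _ : Fintype (𝓞 K ⧸ P) := Fintype.ofFinite _
  obtain ⟨p, hchar⟩ := CharP.exists (𝓞 K ⧸ P)
  obtain ⟨n, hp, hcard⟩ := FiniteField.card (𝓞 K ⧸ P) p
  have hNc : Ideal.absNorm P = p ^ (n : ℕ) := by
    rw [← hcard, Ideal.absNorm_apply, Submodule.cardQuot_apply, Nat.card_eq_fintype_card]
  have hpF : (p : 𝓞 K ⧸ P) = 0 := CharP.cast_eq_zero _ _
  have hpP : (p : 𝓞 K) ∈ P := by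
    rw [← Ideal.Quotient.eq_zero_iff_mem, map_natCast]; exact hpF
  have hn1 : 1 ≤ (n : ℕ) := n.2
  have hple : p ≤ 250 := by
    refine le_trans ?_ hN
    rw [hNc]
    exact Nat.le_self_pow (by omega) p
  set t : 𝓞 K ⧸ P := Ideal.Quotient.mk P th with ht
  have hteq : t ^ 5 = 10 * t ^ 2 + 15 * t + 6 := by
    have := congrArg (Ideal.Quotient.mk P) th_eq
    rwa [map_add, map_add, map_mul, map_mul, map_pow, map_pow, map_ofNat, map_ofNat,
      map_ofNat] at this
  have root : ∀ r : ℕ, r < p → t = r → Submodule.IsPrincipal P := by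
    intro r hr htr
    refine principal_of_root P hP p r hp hpP hr hple ?_
    rw [← Ideal.Quotient.eq_zero_iff_mem, map_sub, map_natCast, ← ht, htr, sub_self]
  have hpow : t ^ (p ^ (n : ℕ)) = t := by
    rw [← hcard]; exact FiniteField.pow_card t
  rcases Nat.eq_or_lt_of_le hn1 with h1 | h2
  · rw [← h1, pow_one] at hcard
    have : Fact p.Prime := ⟨hp⟩
    let e := ZMod.ringEquivOfPrime (𝓞 K ⧸ P) hp hcard
    obtain ⟨x, hx⟩ := e.surjective t
    refine root x.val (ZMod.val_lt x) ?_
    rw [← hx]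
    conv_lhs => rw [← ZMod.natCast_zmod_val x]
    rw [map_natCast]
  · have h3 : p ^ 2 ≤ 250 := le_trans (Nat.pow_le_pow_right hp.pos h2) (hNc ▸ hN)
    have hp15 : p ≤ 15 := by nlinarith
    have hq : p ^ (n : ℕ) = p ^ 2 ∨ p < 7 := by
      by_contra hc
      push Not at hc
      have h4 : 3 ≤ (n : ℕ) := by
        have : (n : ℕ) ≠ 2 := fun h => hc.1 (by rw [h])
        omega
      have h5 : p ^ 3 ≤ 250 := le_trans (Nat.pow_le_pow_right hp.pos h4) (hNc ▸ hN)
      have h6 : 7 ^ 3 ≤ p ^ 3 := Nat.pow_le_pow_left hc.2 3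
      omega
    rcases linFactor t hteq p _ hp hpF hq hp15 hpow with ⟨r, hr, htr⟩ | ⟨rfl, hQ⟩
    · exact root r hr htr
    · have hq2 : Ideal.absNorm P = 169 := by
        rw [hNc]; rcases hq with h | h
        · rw [h]; norm_num
        · omega
      refine principal_of_norm_eq P 1 5 7 (-1) (-1) ?_ ?_ ?_
      · have hQP : -6 - 3 * th + 1 * th ^ 2 ∈ P := by
          rw [← Ideal.Quotient.eq_zero_iff_mem, ← hQ]
          simp [map_ofNat (Ideal.Quotient.mk P), ht]
        have e : (((1 : ℤ) : 𝓞 K)) + (5 : ℤ) * th + (7 : ℤ) * th ^ 2 + (-1 : ℤ) * th ^ 3 +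
            (-1 : ℤ) * th ^ 4 = (-11 - 4*th - 1*th^2) * (-6 - 3 * th + 1 * th ^ 2) + (-5 - 4*th) * ((13 : ℕ) : 𝓞 K) := by
          push_cast; ring
        rw [e]
        exact P.add_mem (P.mul_mem_left _ hQP) (P.mul_mem_left _ hpP)
      · rw [hq2]; decide
      · rw [hq2]; norm_num

open InfinitePlace in
theorem pid : IsPrincipalIdealRing (𝓞 K) := by
  apply RingOfIntegers.isPrincipalIdealRing_of_isPrincipal_of_norm_le_of_isPrime
  intro I hI hle
  refine principal_small I hI (nonZeroDivisors.coe_ne_zero I) ?_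
  rw [nrComplex_eq.1, finrank_K] at hle
  have hsq : √(|(discr K : ℝ)|) ≤ 4025 := by
    rw [Real.sqrt_le_left (by norm_num)]
    have : (|(discr K : ℝ)|) ≤ 16200000 := by exact_mod_cast discr_le
    linarith
  have hpi : (4 / Real.pi) ^ 2 ≤ 1.6213 := by
    rw [div_pow, div_le_iff₀ (by positivity)]
    nlinarith [Real.pi_gt_d4, Real.pi_pos]
  have h3 : ((Nat.factorial 5 : ℕ) : ℝ) / ((5 : ℕ) : ℝ) ^ 5 * √(|(discr K : ℝ)|) ≤ 0.0384 * 4025 := by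
    have : ((Nat.factorial 5 : ℕ) : ℝ) / ((5 : ℕ) : ℝ) ^ 5 = 0.0384 := by
      norm_num [Nat.factorial]
    rw [this]
    linarith
  have h4 := mul_le_mul hpi h3 (by positivity) (by norm_num)
  have h5 : (Ideal.absNorm (I : Ideal (𝓞 K)) : ℝ) < 251 := by
    push_cast at hle h4
    refine lt_of_le_of_lt (le_trans hle h4) (by norm_num)
  have : Ideal.absNorm (I : Ideal (𝓞 K)) < 251 := by exact_mod_cast h5
  omega

end C38

namespace C38

def F {R : Type*} [CommRing R] (u v : R) : R :=
    98304*v^30 + 983040*u*v^29 + 7127040*u^2*v^28 + 54640640*u^3*v^27 + 352788480*u^4*v^26 +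
    1571512320*u^5*v^25 + 4436582400*u^6*v^24 + 6253977600*u^7*v^23 - 8298547200*u^8*v^22 -
    78682521600*u^9*v^21 - 259068349440*u^10*v^20 - 559537228800*u^11*v^19 -
    884230694400*u^12*v^18 - 1073048256000*u^13*v^17 - 1042389734400*u^14*v^16 -
    883549393920*u^15*v^15 - 837634608000*u^16*v^14 - 1189112659200*u^17*v^13 -
    2085326942400*u^18*v^12 - 3274823793600*u^19*v^11 - 4055003448480*u^20*v^10 -
    3830719202400*u^21*v^9 - 2794550176800*u^22*v^8 - 1667196799200*u^23*v^7 -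
    895510575000*u^24*v^6 - 451671056928*u^25*v^5 - 191974420980*u^26*v^4 -
    58334973780*u^27*v^3 - 10541110530*u^28*v^2 - 501967410*u^29*v + 184589480*u^30

def H {R : Type*} [CommRing R] (u v : R) : R :=
    -64*v^12 - 768*u*v^11 - 2112*u^2*v^10 - 3520*u^3*v^9 - 7920*u^4*v^8 - 25344*u^5*v^7 -
    55968*u^6*v^6 - 60192*u^7*v^5 - 33660*u^8*v^4 - 6160*u^9*v^3 + 8844*u^10*v^2 +
    10308*u^11*v + 2207*u^12

def G {R : Type*} [CommRing R] (u v : R) : R :=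
    -2048*v^20 - 10240*u*v^19 + 291840*u^3*v^17 + 2115840*u^4*v^16 + 8054784*u^5*v^15 +
    17802240*u^6*v^14 + 23347200*u^7*v^13 + 11381760*u^8*v^12 - 28138240*u^9*v^11 -
    86058752*u^10*v^10 - 126622080*u^11*v^9 - 131008800*u^12*v^8 - 124725120*u^13*v^7 -
    129741120*u^14*v^6 - 121908864*u^15*v^5 - 78137880*u^16*v^4 - 31156200*u^17*v^3 -
    7981520*u^18*v^2 - 1769020*u^19*v - 442143*u^20

def Fu {R : Type*} [CommRing R] (u v : R) : R :=
    983040*v^29 + 14254080*u*v^28 + 163921920*u^2*v^27 + 1411153920*u^3*v^26 +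
    7857561600*u^4*v^25 + 26619494400*u^5*v^24 + 43777843200*u^6*v^23 - 66388377600*u^7*v^22 -
    708142694400*u^8*v^21 - 2590683494400*u^9*v^20 - 6154909516800*u^10*v^19 -
    10610768332800*u^11*v^18 - 13949627328000*u^12*v^17 - 14593456281600*u^13*v^16 -
    13253240908800*u^14*v^15 - 13402153728000*u^15*v^14 - 20214915206400*u^16*v^13 -
    37535884963200*u^17*v^12 - 62221652078400*u^18*v^11 - 81100068969600*u^19*v^10 -
    80445103250400*u^20*v^9 - 61480103889600*u^21*v^8 - 38345526381600*u^22*v^7 -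
    21492253800000*u^23*v^6 - 11291776423200*u^24*v^5 - 4991334945480*u^25*v^4 -
    1575044292060*u^26*v^3 - 295151094840*u^27*v^2 - 14557054890*u^28*v + 5537684400*u^29

def Fv {R : Type*} [CommRing R] (u v : R) : R :=
    2949120*v^29 + 28508160*u*v^28 + 199557120*u^2*v^27 + 1475297280*u^3*v^26 +
    9172500480*u^4*v^25 + 39287808000*u^5*v^24 + 106477977600*u^6*v^23 + 143841484800*u^7*v^22
    - 182568038400*u^8*v^21 - 1652332953600*u^9*v^20 - 5181366988800*u^10*v^19 -
    10631207347200*u^11*v^18 - 15916152499200*u^12*v^17 - 18241820352000*u^13*v^16 -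
    16678235750400*u^14*v^15 - 13253240908800*u^15*v^14 - 11726884512000*u^16*v^13 -
    15458464569600*u^17*v^12 - 25023923308800*u^18*v^11 - 36023061729600*u^19*v^10 -
    40550034484800*u^20*v^9 - 34476472821600*u^21*v^8 - 22356401414400*u^22*v^7 -
    11670377594400*u^23*v^6 - 5373063450000*u^24*v^5 - 2258355284640*u^25*v^4 -
    767897683920*u^26*v^3 - 175004921340*u^27*v^2 - 21082221060*u^28*v - 501967410*u^29

def Hu {R : Type*} [CommRing R] (u v : R) : R :=
    -768*v^11 - 4224*u*v^10 - 10560*u^2*v^9 - 31680*u^3*v^8 - 126720*u^4*v^7 - 335808*u^5*v^6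
    - 421344*u^6*v^5 - 269280*u^7*v^4 - 55440*u^8*v^3 + 88440*u^9*v^2 + 113388*u^10*v +
    26484*u^11

def Hv {R : Type*} [CommRing R] (u v : R) : R :=
    -768*v^11 - 8448*u*v^10 - 21120*u^2*v^9 - 31680*u^3*v^8 - 63360*u^4*v^7 - 177408*u^5*v^6 -
    335808*u^6*v^5 - 300960*u^7*v^4 - 134640*u^8*v^3 - 18480*u^9*v^2 + 17688*u^10*v +
    10308*u^11

def Gu {R : Type*} [CommRing R] (u v : R) : R :=
    -10240*v^19 + 875520*u^2*v^17 + 8463360*u^3*v^16 + 40273920*u^4*v^15 + 106813440*u^5*v^14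
    + 163430400*u^6*v^13 + 91054080*u^7*v^12 - 253244160*u^8*v^11 - 860587520*u^9*v^10 -
    1392842880*u^10*v^9 - 1572105600*u^11*v^8 - 1621426560*u^12*v^7 - 1816375680*u^13*v^6 -
    1828632960*u^14*v^5 - 1250206080*u^15*v^4 - 529655400*u^16*v^3 - 143667360*u^17*v^2 -
    33611380*u^18*v - 8842860*u^19

def Gv {R : Type*} [CommRing R] (u v : R) : R :=
    -40960*v^19 - 194560*u*v^18 + 4961280*u^3*v^16 + 33853440*u^4*v^15 + 120821760*u^5*v^14 +
    249231360*u^6*v^13 + 303513600*u^7*v^12 + 136581120*u^8*v^11 - 309520640*u^9*v^10 -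
    860587520*u^10*v^9 - 1139598720*u^11*v^8 - 1048070400*u^12*v^7 - 873075840*u^13*v^6 -
    778446720*u^14*v^5 - 609544320*u^15*v^4 - 312551520*u^16*v^3 - 93468600*u^17*v^2 -
    15963040*u^18*v - 1769020*u^19

def Huu {R : Type*} [CommRing R] (u v : R) : R :=
    -4224*v^10 - 21120*u*v^9 - 95040*u^2*v^8 - 506880*u^3*v^7 - 1679040*u^4*v^6 -
    2528064*u^5*v^5 - 1884960*u^6*v^4 - 443520*u^7*v^3 + 795960*u^8*v^2 + 1133880*u^9*v +
    291324*u^10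

def Huv {R : Type*} [CommRing R] (u v : R) : R :=
    -8448*v^10 - 42240*u*v^9 - 95040*u^2*v^8 - 253440*u^3*v^7 - 887040*u^4*v^6 -
    2014848*u^5*v^5 - 2106720*u^6*v^4 - 1077120*u^7*v^3 - 166320*u^8*v^2 + 176880*u^9*v +
    113388*u^10

def Hvv {R : Type*} [CommRing R] (u v : R) : R :=
    -8448*v^10 - 84480*u*v^9 - 190080*u^2*v^8 - 253440*u^3*v^7 - 443520*u^4*v^6 -
    1064448*u^5*v^5 - 1679040*u^6*v^4 - 1203840*u^7*v^3 - 403920*u^8*v^2 - 36960*u^9*v +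
    17688*u^10

def S0 {R : Type*} [CommRing R] (u v : R) : R :=
    4*v^6 - 24*u*v^5 - 30*u^2*v^4 + 50*u^3*v^3 + 165*u^4*v^2 - 3*u^5*v - 62*u^6

def S1 {R : Type*} [CommRing R] (u v : R) : R :=
    8*v^6 - 48*u*v^5 + 220*u^3*v^3 + 510*u^4*v^2 + 54*u^5*v - 139*u^6

def S2 {R : Type*} [CommRing R] (u v : R) : R :=
    -8*u*v^5 + 140*u^2*v^4 + 320*u^3*v^3 + 520*u^4*v^2 + 170*u^5*v - 49*u^6

def S3 {R : Type*} [CommRing R] (u v : R) : R :=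
    -8*v^6 + 16*u*v^5 + 120*u^2*v^4 + 140*u^3*v^3 + 130*u^4*v^2 + 126*u^5*v + 43*u^6

def S4 {R : Type*} [CommRing R] (u v : R) : R :=
    -4*v^6 - 16*u*v^5 - 30*u^2*v^4 - 30*u^3*v^3 - 25*u^4*v^2 + 3*u^5*v - 8*u^6

def T0 {R : Type*} [CommRing R] (u v : R) : R :=
    -2174976*v^24 - 13148160*u*v^23 - 87275520*u^2*v^22 - 754708480*u^3*v^21 -
    4029649920*u^4*v^20 - 12204413952*u^5*v^19 - 14727877120*u^6*v^18 + 38482122240*u^7*v^17 +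
    235462682880*u^8*v^16 + 621356881920*u^9*v^15 + 1107329070336*u^10*v^14 +
    1480700136960*u^11*v^13 + 1512955162240*u^12*v^12 + 1064130906240*u^13*v^11 +
    198791079360*u^14*v^10 - 731191258688*u^15*v^9 - 1214417555280*u^16*v^8 -
    1047682159200*u^17*v^7 - 595519547160*u^18*v^6 - 301512629040*u^19*v^5 -
    180733525236*u^20*v^4 - 84389882260*u^21*v^3 - 17501746410*u^22*v^2 + 209430750*u^23*v +
    193058375*u^24

def T1 {R : Type*} [CommRing R] (u v : R) : R :=
    -2789376*v^24 - 17571840*u*v^23 - 111191040*u^2*v^22 - 978595840*u^3*v^21 -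
    5299223040*u^4*v^20 - 15678269952*u^5*v^19 - 17857780480*u^6*v^18 + 48902688000*u^7*v^17 +
    289674984960*u^8*v^16 + 773077255680*u^9*v^15 + 1432320855936*u^10*v^14 +
    2054313469440*u^11*v^13 + 2370454788160*u^12*v^12 + 2164844462400*u^13*v^11 +
    1425358459680*u^14*v^10 + 457893111712*u^15*v^9 - 224145627120*u^16*v^8 -
    360315135360*u^17*v^7 - 194533198740*u^18*v^6 - 94737915600*u^19*v^5 -
    85659873786*u^20*v^4 - 44592006490*u^21*v^3 - 4371203655*u^22*v^2 + 1967687265*u^23*v -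
    103150570*u^24

def T2 {R : Type*} [CommRing R] (u v : R) : R :=
    118784*v^24 + 808960*u*v^23 + 4664320*u^2*v^22 + 42408960*u^3*v^21 + 235747840*u^4*v^20 +
    666784768*u^5*v^19 + 668926720*u^6*v^18 - 2040564480*u^7*v^17 - 11258672640*u^8*v^16 -
    30806408960*u^9*v^15 - 61838564224*u^10*v^14 - 100347544960*u^11*v^13 -
    136976433600*u^12*v^12 - 159473651200*u^13*v^11 - 159340501600*u^14*v^10 -
    137332645408*u^15*v^9 - 103186601520*u^16*v^8 - 67855255080*u^17*v^7 -
    39855986740*u^18*v^6 - 20616955460*u^19*v^5 - 8677259726*u^20*v^4 - 3469156740*u^21*v^3 -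
    1338636845*u^22*v^2 - 227110835*u^23*v + 33863560*u^24

def T3 {R : Type*} [CommRing R] (u v : R) : R :=
    -188416*v^24 - 1228800*u*v^23 - 7480320*u^2*v^22 - 66734080*u^3*v^21 - 365345280*u^4*v^20
    - 1059973632*u^5*v^19 - 1146374400*u^6*v^18 + 3277520640*u^7*v^17 + 18858746880*u^8*v^16 +
    50838976000*u^9*v^15 + 97389422976*u^10*v^14 + 147515424000*u^11*v^13 +
    184479999040*u^12*v^12 + 191661272640*u^13*v^11 + 162867287520*u^14*v^10 +
    110466256992*u^15*v^9 + 60951974400*u^16*v^8 + 31840826400*u^17*v^7 + 19402540940*u^18*v^6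
    + 10290545880*u^19*v^5 + 2561081574*u^20*v^4 + 619284950*u^21*v^3 + 734727915*u^22*v^2 +
    229464675*u^23*v - 26966610*u^24

def T4 {R : Type*} [CommRing R] (u v : R) : R :=
    272384*v^24 + 1710080*u*v^23 + 10869760*u^2*v^22 + 95498240*u^3*v^21 + 516416000*u^4*v^20
    + 1530861568*u^5*v^19 + 1752399360*u^6*v^18 - 4782259200*u^7*v^17 - 28403796480*u^8*v^16 -
    75717520640*u^9*v^15 - 139781815424*u^10*v^14 - 199258439680*u^11*v^13 -
    227705291840*u^12*v^12 - 204369754880*u^13*v^11 - 128911735360*u^14*v^10 -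
    32477457408*u^15*v^9 + 33559104840*u^16*v^8 + 43774600440*u^17*v^7 + 23954257100*u^18*v^6
    + 11787911120*u^19*v^5 + 9634847074*u^20*v^4 + 4908847880*u^21*v^3 + 584602670*u^22*v^2 -
    177362180*u^23*v + 6990195*u^24

theorem conv0 {R : Type*} [CommRing R] (u v : R) :
    2 * ((S0 u v * T0 u v) + 6 * (S1 u v * T4 u v + S2 u v * T3 u v + S3 u v * T2 u v + S4 u v
    * T1 u v) + 60 * (S4 u v * T4 u v)) = 5 * F u v := by
  simp only [S0, S1, S2, S3, S4, T0, T1, T2, T3, T4, F]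
  ring

theorem conv1 {R : Type*} [CommRing R] (u v : R) :
    (S0 u v * T1 u v + S1 u v * T0 u v) + 15 * (S1 u v * T4 u v + S2 u v * T3 u v + S3 u v *
    T2 u v + S4 u v * T1 u v) + 6 * (S2 u v * T4 u v + S3 u v * T3 u v + S4 u v * T2 u v) +
    150 * (S4 u v * T4 u v) = 0 := by
  simp only [S0, S1, S2, S3, S4, T0, T1, T2, T3, T4]
  ring

theorem conv2 {R : Type*} [CommRing R] (u v : R) :
    (S0 u v * T2 u v + S1 u v * T1 u v + S2 u v * T0 u v) + 10 * (S1 u v * T4 u v + S2 u v *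
    T3 u v + S3 u v * T2 u v + S4 u v * T1 u v) + 15 * (S2 u v * T4 u v + S3 u v * T3 u v + S4
    u v * T2 u v) + 6 * (S3 u v * T4 u v + S4 u v * T3 u v) + 100 * (S4 u v * T4 u v) = 0 := by
  simp only [S0, S1, S2, S3, S4, T0, T1, T2, T3, T4]
  ring

theorem conv3 {R : Type*} [CommRing R] (u v : R) :
    (S0 u v * T3 u v + S1 u v * T2 u v + S2 u v * T1 u v + S3 u v * T0 u v) + 10 * (S2 u v *
    T4 u v + S3 u v * T3 u v + S4 u v * T2 u v) + 15 * (S3 u v * T4 u v + S4 u v * T3 u v) + 6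
    * (S4 u v * T4 u v) = 0 := by
  simp only [S0, S1, S2, S3, S4, T0, T1, T2, T3, T4]
  ring

theorem conv4 {R : Type*} [CommRing R] (u v : R) :
    (S0 u v * T4 u v + S1 u v * T3 u v + S2 u v * T2 u v + S3 u v * T1 u v + S4 u v * T0 u v)
    + 10 * (S3 u v * T4 u v + S4 u v * T3 u v) + 15 * (S4 u v * T4 u v) = 0 := by
  simp only [S0, S1, S2, S3, S4, T0, T1, T2, T3, T4]
  ring

theorem normS {R : Type*} [CommRing R] (u v : R) :
    2 * N5 (S0 u v) (S1 u v) (S2 u v) (S3 u v) (S4 u v) = - (5 * F u v) := by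
  simp only [S0, S1, S2, S3, S4, N5, F]
  ring

theorem g_identity {R : Type*} [CommRing R] (u v : R) :
    Huu u v * Hvv u v - Huv u v * Huv u v = 17424 * G u v := by
  simp only [Huu, Hvv, Huv, G]
  ring

theorem f_identity {R : Type*} [CommRing R] (u v : R) :
    Hu u v * Gv u v - Hv u v * Gu u v = 240 * F u v := by
  simp only [Hu, Hv, Gu, Gv, F]
  ring

theorem jacH {R : Type*} [CommRing R] (u v : R) :
    Fu u v * Hv u v - Fv u v * Hu u v = 360 * G u v ^ 2 := by
  simp only [Hu, Hv, Fu, Fv, G]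
  ring

theorem jacG {R : Type*} [CommRing R] (u v : R) :
    Fu u v * Gv u v - Fv u v * Gu u v = - (600 * H u v ^ 4) := by
  simp only [Gu, Gv, Fu, Fv, H]
  ring

def Bgu {R : Type*} [CommRing R] (u v : R) : R :=
    384384*v^11 + 4484480*u*v^10 + 11211200*u^2*v^9 + 17629040*u^3*v^8 + 42053440*u^4*v^7 +
    138708064*u^5*v^6 + 291611584*u^6*v^5 + 270006440*u^7*v^4 + 121514360*u^8*v^3 -
    395440*u^9*v^2 - 51309084*u^10*v - 45959145*u^11

def Bhu {R : Type*} [CommRing R] (u v : R) : R :=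
    -12300288*v^19 - 57401344*u*v^18 + 18450432*u^2*v^17 + 1744224768*u^3*v^16 +
    12130280448*u^4*v^15 + 44426578944*u^5*v^14 + 92678530560*u^6*v^13 + 111131530048*u^7*v^12
    + 34284332544*u^8*v^11 - 178008933312*u^9*v^10 - 458856905920*u^10*v^9 -
    616100583312*u^11*v^8 - 596603428416*u^12*v^7 - 565424087712*u^13*v^6 -
    604235992128*u^14*v^5 - 545296959732*u^15*v^4 - 302925305264*u^16*v^3 -
    96418615116*u^17*v^2 - 18509828196*u^18*v - 6125088105*u^19

theorem bez_u {R : Type*} [CommRing R] (u v : R) :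
    Bgu u v * G u v + Bhu u v * H u v = 6802444800000 * u ^ 31 := by
  simp only [Bgu, Bhu, G, H]
  ring

def Bgv {R : Type*} [CommRing R] (u v : R) : R :=
    -138328318720112*v^11 - 376111004549600*u*v^10 - 645765629659280*u^2*v^9 -
    1185489015967520*u^3*v^8 - 4586880334632200*u^4*v^7 - 10654349938001264*u^5*v^6 -
    11474349324792640*u^6*v^5 - 6404414851549000*u^7*v^4 - 1208375681894095*u^8*v^3 +
    1753255876902530*u^9*v^2 + 1941616105397969*u^10*v + 407796371342360*u^11

def Bhv {R : Type*} [CommRing R] (u v : R) : R :=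
    2685080330243584*v^19 + 1947119177882112*u*v^18 - 31130820155590656*u^2*v^17 -
    327883493273684224*u^3*v^16 - 1429193245602502464*u^4*v^15 - 3335108386157591808*u^5*v^14
    - 4544651264813604352*u^6*v^13 - 2546957075922847872*u^7*v^12 +
    4857516588687552720*u^8*v^11 + 16019445133659751616*u^9*v^10 +
    23783186429063983824*u^10*v^9 + 24442452252402192624*u^11*v^8 +
    23190265422243213140*u^12*v^7 + 24516363596667550608*u^13*v^6 +
    23182374115056145704*u^14*v^5 + 14788426253965590512*u^15*v^4 +
    5853988802000642589*u^16*v^3 + 1493682293266068906*u^17*v^2 + 334274468322715921*u^18*v +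
    81696561402095640*u^19

theorem bez_v {R : Type*} [CommRing R] (u v : R) :
    Bgv u v * G u v + Bhv u v * H u v = 111451255603200000 * v ^ 31 := by
  simp only [Bgv, Bhv, G, H]
  ring

end C38

namespace C38

theorem coef_alpha (i : Fin 13) : (Nat.choose 12 i : ℚ) * alphaC38 i =
    (![-64, -768, -2112, -3520, -7920, -25344, -55968, -60192, -33660, -6160, 8844, 10308, 2207] :
      Fin 13 → ℚ) i := by
  fin_cases i <;> simp [alphaC38, Nat.choose] <;> norm_num

theorem hC38_eq : hC38 = H (X 0) (X 1) := by
  simp only [hC38, coef_alpha]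
  simp only [Fin.sum_univ_succ, H]
  simp [map_ofNat (C : ℚ →+* MvPolynomial (Fin 2) ℚ)]
  ring

theorem pderiv_num (i : Fin 2) (n : ℕ) [n.AtLeastTwo] :
    pderiv i (ofNat(n) : MvPolynomial (Fin 2) ℚ) = 0 :=
  Derivation.map_natCast _ n

theorem pd0H : pderiv 0 (H (X 0) (X 1) : MvPolynomial (Fin 2) ℚ) = Hu (X 0) (X 1) := by
  simp [H, Hu, pderiv_X, pderiv_num, Derivation.leibniz, Derivation.leibniz_pow]
  ring

theorem pd1H : pderiv 1 (H (X 0) (X 1) : MvPolynomial (Fin 2) ℚ) = Hv (X 0) (X 1) := by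
  simp [H, Hv, pderiv_X, pderiv_num, Derivation.leibniz, Derivation.leibniz_pow]
  ring

theorem pd00H : pderiv 0 (Hu (X 0) (X 1) : MvPolynomial (Fin 2) ℚ) = Huu (X 0) (X 1) := by
  simp [Hu, Huu, pderiv_X, pderiv_num, Derivation.leibniz, Derivation.leibniz_pow]
  ring

theorem pd01H : pderiv 1 (Hu (X 0) (X 1) : MvPolynomial (Fin 2) ℚ) = Huv (X 0) (X 1) := by
  simp [Hu, Huv, pderiv_X, pderiv_num, Derivation.leibniz, Derivation.leibniz_pow]
  ring

theorem pd11H : pderiv 1 (Hv (X 0) (X 1) : MvPolynomial (Fin 2) ℚ) = Hvv (X 0) (X 1) := by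
  simp [Hv, Hvv, pderiv_X, pderiv_num, Derivation.leibniz, Derivation.leibniz_pow]
  ring

theorem pd0G : pderiv 0 (G (X 0) (X 1) : MvPolynomial (Fin 2) ℚ) = Gu (X 0) (X 1) := by
  simp [G, Gu, pderiv_X, pderiv_num, Derivation.leibniz, Derivation.leibniz_pow]
  ring

theorem pd1G : pderiv 1 (G (X 0) (X 1) : MvPolynomial (Fin 2) ℚ) = Gv (X 0) (X 1) := by
  simp [G, Gv, pderiv_X, pderiv_num, Derivation.leibniz, Derivation.leibniz_pow]
  ring

theorem gC38_eq : gC38 = G (X 0) (X 1) := by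
  rw [gC38, hC38_eq, pd0H, pd1H, pd00H, pd01H, pd11H, g_identity,
    ← map_ofNat (C : ℚ →+* MvPolynomial (Fin 2) ℚ) 17424, ← mul_assoc, ← map_mul]
  norm_num

theorem fC38_eq : fC38 = F (X 0) (X 1) := by
  rw [fC38, hC38_eq, gC38_eq, pd0H, pd1H, pd0G, pd1G, f_identity,
    ← map_ofNat (C : ℚ →+* MvPolynomial (Fin 2) ℚ) 240, ← mul_assoc, ← map_mul]
  norm_num

theorem map_F {R S : Type*} [CommRing R] [CommRing S] (φ : R →+* S) (u v : R) :
    φ (F u v) = F (φ u) (φ v) := by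
  simp [F, map_ofNat φ]

theorem fC38_eval (u v : ℤ) : eval ![(u : ℚ), (v : ℚ)] fC38 = ((F u v : ℤ) : ℚ) := by
  rw [fC38_eq, map_F]
  have := map_F (Int.castRingHom ℚ) u v
  simp only [eq_intCast] at this
  rw [this]
  simp

theorem fC38_int (m : Fin 2 →₀ ℕ) : ∃ z : ℤ, coeff m fC38 = (z : ℚ) := by
  have := map_F (MvPolynomial.map (σ := Fin 2) (Int.castRingHom ℚ)) (X 0) (X 1)
  rw [map_X, map_X, ← fC38_eq] at this
  rw [← this, coeff_map]
  exact ⟨_, rfl⟩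

theorem hC38_hom : hC38.IsHomogeneous 12 := by
  unfold hC38
  refine IsHomogeneous.sum _ _ _ fun i _ => ?_
  have h := ((isHomogeneous_C (Fin 2) ((Nat.choose 12 i : ℚ) * alphaC38 i)).mul
    (isHomogeneous_X_pow (R := ℚ) (0 : Fin 2) (i : ℕ))).mul
    (isHomogeneous_X_pow (R := ℚ) (1 : Fin 2) (12 - (i : ℕ)))
  have e : 0 + (i : ℕ) + (12 - (i : ℕ)) = 12 := by omega
  rwa [e] at h

theorem gC38_hom : gC38.IsHomogeneous 20 := by
  unfold gC38
  exact IsHomogeneous.C_mul ((hC38_hom.pderiv.pderiv.mul hC38_hom.pderiv.pderiv).sub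
    (hC38_hom.pderiv.pderiv.mul hC38_hom.pderiv.pderiv)) _

theorem fC38_hom : fC38.IsHomogeneous 30 := by
  unfold fC38
  exact IsHomogeneous.C_mul ((hC38_hom.pderiv.mul gC38_hom.pderiv).sub
    (hC38_hom.pderiv.mul gC38_hom.pderiv)) _

theorem F_scale {R : Type*} [CommRing R] (c u v : R) : F (c * u) (c * v) = c ^ 30 * F u v := by
  simp only [F]
  ring

end C38

namespace C38

/-- The linear combination of powers of `t` with coefficients the sextic forms `S0, …, S4`. -/
def ss {R : Type*} [CommRing R] (t u v : R) : R :=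
  S0 u v + S1 u v * t + S2 u v * t ^ 2 + S3 u v * t ^ 3 + S4 u v * t ^ 4

/-- The complementary factor. -/
def tt {R : Type*} [CommRing R] (t u v : R) : R :=
  T0 u v + T1 u v * t + T2 u v * t ^ 2 + T3 u v * t ^ 3 + T4 u v * t ^ 4

theorem ss_tt {R : Type*} [CommRing R] (t u v : R) (ht : t ^ 5 = 10 * t ^ 2 + 15 * t + 6) :
    2 * (ss t u v * tt t u v) = 5 * F u v := by
  have c0 := conv0 u v
  have c1 := conv1 u v
  have c2 := conv2 u v
  have c3 := conv3 u v
  have c4 := conv4 u v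
  unfold ss tt
  generalize F u v = f at *
  generalize S0 u v = s0 at *
  generalize S1 u v = s1 at *
  generalize S2 u v = s2 at *
  generalize S3 u v = s3 at *
  generalize S4 u v = s4 at *
  generalize T0 u v = t0 at *
  generalize T1 u v = t1 at *
  generalize T2 u v = t2 at *
  generalize T3 u v = t3 at *
  generalize T4 u v = t4 at *
  linear_combination c0 + 2 * t * c1 + 2 * t ^ 2 * c2 + 2 * t ^ 3 * c3 + 2 * t ^ 4 * c4 +
    2 * ((s1 * t4 + s2 * t3 + s3 * t2 + s4 * t1) + (s2 * t4 + s3 * t3 + s4 * t2) * t + (s3 * t4 + s4 * t3) * t ^ 2 + (s4 * t4) * (t ^ 3 + 10)) * ht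

theorem map_ss {R S : Type*} [CommRing R] [CommRing S] (φ : R →+* S) (t u v : R) :
    φ (ss t u v) = ss (φ t) (φ u) (φ v) := by
  simp [ss, S0, S1, S2, S3, S4, map_ofNat φ]

theorem map_tt {R S : Type*} [CommRing R] [CommRing S] (φ : R →+* S) (t u v : R) :
    φ (tt t u v) = tt (φ t) (φ u) (φ v) := by
  simp [tt, T0, T1, T2, T3, T4, map_ofNat φ]

theorem der_u {R : Type*} [CommRing R] (v : R) :
    Polynomial.derivative (F Polynomial.X (Polynomial.C v)) =
      Fu Polynomial.X (Polynomial.C v) := by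
  simp [F, Fu, Polynomial.derivative_mul,
    Polynomial.derivative_pow, map_ofNat (Polynomial.C (R := R))]
  ring

theorem der_v {R : Type*} [CommRing R] (u : R) :
    Polynomial.derivative (F (Polynomial.C u) Polynomial.X) =
      Fv (Polynomial.C u) Polynomial.X := by
  simp [F, Fv, Polynomial.derivative_mul,
    Polynomial.derivative_pow, map_ofNat (Polynomial.C (R := R))]
  ring

theorem dvd_der_aux {R : Type*} [CommRing R] (q u : R) (A B C D : Polynomial R)
    (h : 2 * (A * B) = 5 * C) (hD : Polynomial.derivative C = D)
    (hA : q ∣ A.eval u) (hB : q ∣ B.eval u) : q ∣ 5 * D.eval u := by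
  have h1 := congrArg (fun p => (Polynomial.derivative p).eval u) h
  simp only [Polynomial.derivative_mul, Polynomial.derivative_ofNat, hD, zero_mul, zero_add,
    Polynomial.eval_mul, Polynomial.eval_add, Polynomial.eval_ofNat] at h1
  rw [← h1]
  exact Dvd.dvd.mul_left (dvd_add (Dvd.dvd.mul_left hB _) (Dvd.dvd.mul_right hA _)) _

theorem dvd_Fu {R : Type*} [CommRing R] (q t u v : R) (ht : t ^ 5 = 10 * t ^ 2 + 15 * t + 6)
    (h1 : q ∣ ss t u v) (h2 : q ∣ tt t u v) : q ∣ 5 * Fu u v := by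
  have ht' : (Polynomial.C t) ^ 5 = 10 * (Polynomial.C t) ^ 2 + 15 * Polynomial.C t + 6 := by
    have := congrArg (Polynomial.C (R := R)) ht
    simpa [map_ofNat (Polynomial.C (R := R))] using this
  have key := dvd_der_aux q u _ _ _ _ (ss_tt (Polynomial.C t) Polynomial.X (Polynomial.C v) ht')
    (der_u v) ?_ ?_
  · convert key using 2
    simp [Fu]
    ring
  · have := map_ss (Polynomial.evalRingHom u) (Polynomial.C t) Polynomial.X (Polynomial.C v)
    simp only [Polynomial.coe_evalRingHom, Polynomial.eval_C, Polynomial.eval_X] at this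
    rwa [this]
  · have := map_tt (Polynomial.evalRingHom u) (Polynomial.C t) Polynomial.X (Polynomial.C v)
    simp only [Polynomial.coe_evalRingHom, Polynomial.eval_C, Polynomial.eval_X] at this
    rwa [this]

theorem dvd_Fv {R : Type*} [CommRing R] (q t u v : R) (ht : t ^ 5 = 10 * t ^ 2 + 15 * t + 6)
    (h1 : q ∣ ss t u v) (h2 : q ∣ tt t u v) : q ∣ 5 * Fv u v := by
  have ht' : (Polynomial.C t) ^ 5 = 10 * (Polynomial.C t) ^ 2 + 15 * Polynomial.C t + 6 := by
    have := congrArg (Polynomial.C (R := R)) ht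
    simpa [map_ofNat (Polynomial.C (R := R))] using this
  have key := dvd_der_aux q v _ _ _ _ (ss_tt (Polynomial.C t) (Polynomial.C u) Polynomial.X ht')
    (der_v u) ?_ ?_
  · convert key using 2
    simp [Fv]
  · have := map_ss (Polynomial.evalRingHom v) (Polynomial.C t) (Polynomial.C u) Polynomial.X
    simp only [Polynomial.coe_evalRingHom, Polynomial.eval_C, Polynomial.eval_X] at this
    rwa [this]
  · have := map_tt (Polynomial.evalRingHom v) (Polynomial.C t) (Polynomial.C u) Polynomial.X
    simp only [Polynomial.coe_evalRingHom, Polynomial.eval_C, Polynomial.eval_X] at this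
    rwa [this]

/-- A prime not dividing `30` cannot divide both factors when `u, v` are coprime. -/
theorem no_common {R : Type*} [CommRing R] (q t u v : R)
    (ht : t ^ 5 = 10 * t ^ 2 + 15 * t + 6) (hq : Prime q) (h30 : ¬ q ∣ 30)
    (hc : IsCoprime u v)
    (h1 : q ∣ ss t u v) (h2 : q ∣ tt t u v) : False := by
  have n2 : ¬ q ∣ 2 := fun h => h30 (by
    have : (30 : R) = 2 * 15 := by norm_num
    rw [this]; exact h.mul_right _)
  have n3 : ¬ q ∣ 3 := fun h => h30 (by
    have : (30 : R) = 3 * 10 := by norm_num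
    rw [this]; exact h.mul_right _)
  have n5 : ¬ q ∣ 5 := fun h => h30 (by
    have : (30 : R) = 5 * 6 := by norm_num
    rw [this]; exact h.mul_right _)
  have can : ∀ (a b c : ℕ) (x : R), q ∣ 2 ^ a * 3 ^ b * 5 ^ c * x → q ∣ x := by
    intro a b c x h
    rcases hq.dvd_or_dvd h with h | h
    · exfalso
      rcases hq.dvd_or_dvd h with h | h
      · rcases hq.dvd_or_dvd h with h | h
        · exact n2 (hq.dvd_of_dvd_pow h)
        · exact n3 (hq.dvd_of_dvd_pow h)
      · exact n5 (hq.dvd_of_dvd_pow h)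
    · exact h
  have fu : q ∣ Fu u v := can 0 0 1 _ (by simpa using dvd_Fu q t u v ht h1 h2)
  have fv : q ∣ Fv u v := can 0 0 1 _ (by simpa using dvd_Fv q t u v ht h1 h2)
  have hG : q ∣ G u v := by
    apply hq.dvd_of_dvd_pow (n := 2)
    apply can 3 2 1
    have := dvd_sub (fu.mul_right (Hv u v)) (fv.mul_right (Hu u v))
    rw [jacH] at this
    convert this using 1
    norm_num
  have hH : q ∣ H u v := by
    apply hq.dvd_of_dvd_pow (n := 4)
    apply can 3 1 2
    have := dvd_sub (fu.mul_right (Gv u v)) (fv.mul_right (Gu u v))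
    rw [jacG, dvd_neg] at this
    convert this using 1
    norm_num
  have hu : q ∣ u := by
    apply hq.dvd_of_dvd_pow (n := 31)
    apply can 12 12 5
    have := dvd_add (hG.mul_left (Bgu u v)) (hH.mul_left (Bhu u v))
    rw [bez_u] at this
    convert this using 1
    norm_num
  have hv : q ∣ v := by
    apply hq.dvd_of_dvd_pow (n := 31)
    apply can 26 12 5
    have := dvd_add (hG.mul_left (Bgv u v)) (hH.mul_left (Bhv u v))
    rw [bez_v] at this
    convert this using 1
    norm_num
  exact hq.not_isUnit (hc.isUnit_of_dvd' hu hv)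

end C38

namespace C38

theorem loc2 (k v : ℤ) : ∃ Q : ℤ, F (2 * k) v = 2 ^ 15 * (v ^ 30 + 2 * Q) := by
  refine ⟨
    v^30 + 30*k*v^29 + 435*k^2*v^28 + 6670*k^3*v^27 + 86130*k^4*v^26 + 767340*k^5*v^25 +
    4332600*k^6*v^24 + 12214800*k^7*v^23 - 32416200*k^8*v^22 - 614707200*k^9*v^21 -
    4047942960*k^10*v^20 - 17485538400*k^11*v^19 - 55264418400*k^12*v^18 -
    134131032000*k^13*v^17 - 260597433600*k^14*v^16 - 441774696960*k^15*v^15 -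
    837634608000*k^16*v^14 - 2378225318400*k^17*v^13 - 8341307769600*k^18*v^12 -
    26198590348800*k^19*v^11 - 64880055175680*k^20*v^10 - 122583014476800*k^21*v^9 -
    178851211315200*k^22*v^8 - 213401190297600*k^23*v^7 - 229250707200000*k^24*v^6 -
    231255581147136*k^25*v^5 - 196581807083520*k^26*v^4 - 119470026301440*k^27*v^3 -
    43176388730880*k^28*v^2 - 4112117022720*k^29*v + 3024314040320*k^30, ?_⟩
  simp only [F]
  ring

theorem loc3a (k v : ℤ) : ∃ Q : ℤ, F (3 * k) v = 3 ^ 1 * (2 * v ^ 30 + 3 * Q) := by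
  refine ⟨
    10922*v^30 + 327680*k*v^29 + 7127040*k^2*v^28 + 163921920*k^3*v^27 + 3175096320*k^4*v^26 +
    42430832640*k^5*v^25 + 359363174400*k^6*v^24 + 1519716556800*k^7*v^23 -
    6049640908800*k^8*v^22 - 172078674739200*k^9*v^21 - 1699747440675840*k^10*v^20 -
    11013371274470400*k^11*v^19 - 52212938273625600*k^12*v^18 - 190087279405632000*k^13*v^17 -
    553968642839270400*k^14*v^16 - 1408663120362716160*k^15*v^15 -
    4006380363391152000*k^16*v^14 - 17062466959383494400*k^17*v^13 -
    89766487083275870400*k^18*v^12 - 422911278501782356800*k^19*v^11 -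
    1570991418906807906720*k^20*v^10 - 4452297319846493920800*k^21*v^9 -
    9743993964278032096800*k^22*v^8 - 17439467378543067837600*k^23*v^7 -
    28102070734564865175000*k^24*v^6 - 42521749083352801263456*k^25*v^5 -
    54219246733589761771380*k^26*v^4 - 49426558815950065404540*k^27*v^3 -
    26794088648845994204370*k^28*v^2 - 3827801419241438273670*k^29*v +
    4222815223329174410280*k^30, ?_⟩
  simp only [F]
  ring

theorem loc3b (k v : ℤ) : ∃ Q : ℤ, F (3 * k - v) v = 3 ^ 9 * (2 * v ^ 30 + 3 * Q) := by
  refine ⟨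
    -4246*v^30 + 100110*k*v^29 + 2871000*k^2*v^28 - 186802920*k^3*v^27 + 4645006560*k^4*v^26 -
    73279709370*k^5*v^25 + 837461251800*k^6*v^24 - 7394394549600*k^7*v^23 +
    52572593160000*k^8*v^22 - 311120225271450*k^9*v^21 + 1582794893385720*k^10*v^20 -
    7166432453113800*k^11*v^19 + 29887022076616800*k^12*v^18 - 117604867632192450*k^13*v^17 +
    438230292263710200*k^14*v^16 - 1522143645699191040*k^15*v^15 +
    4812968966043700800*k^16*v^14 - 13564910520215544150*k^17*v^13 +
    33574748971845025800*k^18*v^12 - 72297479504907646200*k^19*v^11 +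
    134649418236581377440*k^20*v^10 - 215996191699333272750*k^21*v^9 +
    297176186352722632200*k^22*v^8 - 348476016820358455200*k^23*v^7 +
    344473720075545624000*k^24*v^6 - 281677226210407614366*k^25*v^5 +
    184730427575391107880*k^26*v^4 - 92518070776665600600*k^27*v^3 +
    32664338901295230240*k^28*v^2 - 7019654572859805270*k^29*v + 643623719452701480*k^30, ?_⟩
  simp only [F]
  ring

theorem loc3c (k v : ℤ) : ∃ Q : ℤ, F (3 * k + v) v = (v ^ 30 + 3 * Q) := by
  refine ⟨
    -8706281387055*v^30 - 496247360115510*k*v^29 - 13884405855018120*k^2*v^28 -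
    252865281150536040*k^3*v^27 - 3354935920995621060*k^4*v^26 - 34432883393648791950*k^5*v^25
    - 283692504900963454200*k^6*v^24 - 1924003428653880345600*k^7*v^23 -
    10937142421961086826100*k^8*v^22 - 52825866737430985210350*k^9*v^21 -
    219069852071817735559080*k^10*v^20 - 786400020433011995260200*k^11*v^19 -
    2458882243254000903419700*k^12*v^18 - 6727496403250380209019750*k^13*v^17 -
    16154828231148884651419800*k^14*v^16 - 34097472109151905543606080*k^15*v^15 -
    63248608233037237517095500*k^16*v^14 - 102914546547036103227180450*k^17*v^13 -
    146338720586636101569451800*k^18*v^12 - 180760777112126430630905400*k^19*v^11 -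
    192285924644164355782844940*k^20*v^10 - 174003585426494653541524650*k^21*v^9 -
    131600393447183008012218600*k^22*v^8 - 80969745487606463181124800*k^23*v^7 -
    38697038836041724285837500*k^24*v^6 - 13011071044185082774820538*k^25*v^5 -
    2141159922518928233663160*k^26*v^4 + 488415583393392664775880*k^27*v^3 +
    420919700278190596941060*k^28*v^2 + 115201052442150917487390*k^29*v +
    12668445669987523230840*k^30, ?_⟩
  simp only [F]
  ring

theorem loc3d (u k : ℤ) : ∃ Q : ℤ, F u (3 * k) = 2 * u ^ 30 + 3 * Q := by
  refine ⟨
    6746640616477458432*k^30 + 22488802054924861440*u*k^29 + 54347938299401748480*u^2*k^28 +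
    138889175654026690560*u^3*k^27 + 298913660646709616640*u^4*k^26 +
    443841496111780945920*u^5*k^25 + 417673970263920844800*u^6*k^24 +
    196256443858950758400*u^7*k^23 - 86805734783766681600*u^8*k^22 -
    274348988946225561600*u^9*k^21 - 301105159873403028480*u^10*k^20 -
    216776186795400883200*u^11*k^19 - 114189696004419187200*u^12*k^18 -
    46191208895568576000*u^13*k^17 - 14957153356660300800*u^14*k^16 -
    4225989361088148480*u^15*k^15 - 1335460121130384000*u^16*k^14 -
    631943220717907200*u^17*k^13 - 369409411865332800*u^18*k^12 - 193375070188286400*u^19*k^11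
    - 79814632876431840*u^20*k^10 - 25133348686946400*u^21*k^9 - 6111681236661600*u^22*k^8 -
    1215386466616800*u^23*k^7 - 217609069725000*u^24*k^6 - 36585355611168*u^25*k^5 -
    5183309366460*u^26*k^4 - 525014764020*u^27*k^3 - 31623331590*u^28*k^2 - 501967410*u^29*k +
    61529826*u^30, ?_⟩
  simp only [F]
  ring

theorem sq_odd_pow (p : ℤ) (hp : Prime p) (n : ℕ) (y m : ℤ)
    (h : y ^ 2 = p ^ (2 * n + 1) * m) : p ∣ m := by
  have h1 : (p ^ n) ^ 2 ∣ y ^ 2 := ⟨p * m, by rw [h]; ring⟩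
  obtain ⟨z, rfl⟩ := (Int.pow_dvd_pow_iff (by norm_num)).1 h1
  have hp0 : (p ^ n) ^ 2 ≠ 0 := pow_ne_zero _ (pow_ne_zero _ hp.ne_zero)
  have h2 : z ^ 2 = p * m := by
    apply mul_left_cancel₀ hp0
    linear_combination h
  obtain ⟨w, rfl⟩ := hp.dvd_of_dvd_pow (Dvd.intro _ h2.symm)
  refine ⟨w ^ 2, ?_⟩
  apply mul_left_cancel₀ hp.ne_zero
  linear_combination -h2

theorem local_facts (u v y : ℤ) (hc : IsCoprime u v) (hy : y ^ 2 = - F u v) :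
    (∃ k, u = 2 * k + 1) ∧ (∃ k, v = 3 * k) ∧ ¬ (3 ∣ u) ∧ ¬ (3 ∣ y) := by
  have p2 : Prime (2 : ℤ) := Int.prime_two
  have p3 : Prime (3 : ℤ) := Int.prime_three
  have hu : ∃ k, u = 2 * k + 1 := by
    rcases Int.even_or_odd' u with ⟨k, rfl | hk⟩
    · exfalso
      obtain ⟨Q, hQ⟩ := loc2 k v
      rw [hQ] at hy
      have h := sq_odd_pow 2 p2 7 y (-(v ^ 30 + 2 * Q)) (by rw [hy]; ring)
      have h2 : (2 : ℤ) ∣ v ^ 30 := by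
        rw [dvd_neg] at h
        omega
      have h3 := p2.dvd_of_dvd_pow h2
      exact p2.not_isUnit (hc.isUnit_of_dvd' (Dvd.intro _ rfl) h3)
    · exact ⟨k, hk⟩
  have hv : ∃ k, v = 3 * k := by
    by_contra hne
    have hv3 : ¬ (3 : ℤ) ∣ v := fun ⟨k, hk⟩ => hne ⟨k, hk⟩
    have hv30 : ¬ (3 : ℤ) ∣ v ^ 30 := fun h => hv3 (p3.dvd_of_dvd_pow h)
    have hsq : ∀ x : ℤ, ¬ 3 ∣ x → x ^ 2 % 3 = 1 := by
      intro x hx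
      have : x % 3 = 1 ∨ x % 3 = 2 := by omega
      rcases this with h | h <;> simp [pow_two, Int.mul_emod, h]
    have cases3 : (∃ k, u = 3 * k) ∨ (∃ k, u = 3 * k - v) ∨ (∃ k, u = 3 * k + v) := by
      have h1 : (∃ k, u = 3 * k) ∨ (3 : ℤ) ∣ u + v ∨ (3 : ℤ) ∣ u - v := by
        by_cases h : (3 : ℤ) ∣ u
        · exact Or.inl h
        · right
          have a1 : u % 3 = 1 ∨ u % 3 = 2 := by omega
          have a2 : v % 3 = 1 ∨ v % 3 = 2 := by omega
          rcases a1 with a1 | a1 <;> rcases a2 with a2 | a2 <;> omega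
      rcases h1 with h | ⟨k, h⟩ | ⟨k, h⟩
      · exact Or.inl h
      · exact Or.inr (Or.inl ⟨k, by linarith⟩)
      · exact Or.inr (Or.inr ⟨k, by linarith⟩)
    rcases cases3 with ⟨k, rfl⟩ | ⟨k, rfl⟩ | ⟨k, rfl⟩
    · obtain ⟨Q, hQ⟩ := loc3a k v
      rw [hQ] at hy
      have h := sq_odd_pow 3 p3 0 y (-(2 * v ^ 30 + 3 * Q)) (by rw [hy]; ring)
      rw [dvd_neg] at h
      omega
    · obtain ⟨Q, hQ⟩ := loc3b k v
      rw [hQ] at hy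
      have h := sq_odd_pow 3 p3 4 y (-(2 * v ^ 30 + 3 * Q)) (by rw [hy]; ring)
      rw [dvd_neg] at h
      omega
    · obtain ⟨Q, hQ⟩ := loc3c k v
      rw [hQ] at hy
      have e : v ^ 30 = (v ^ 15) ^ 2 := by ring
      have h1 := hsq (v ^ 15) (fun h => hv3 (p3.dvd_of_dvd_pow h))
      rw [← e] at h1
      by_cases h : (3 : ℤ) ∣ y
      · obtain ⟨z, rfl⟩ := h
        have : (3 * z) ^ 2 = 3 * (3 * z ^ 2) := by ring
        omega
      · have h2 := hsq y h
        omega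
  obtain ⟨k, rfl⟩ := hv
  have hu3 : ¬ (3 : ℤ) ∣ u := fun h =>
    p3.not_isUnit (hc.isUnit_of_dvd' h (Dvd.intro _ rfl))
  refine ⟨hu, ⟨k, rfl⟩, hu3, ?_⟩
  rintro ⟨z, rfl⟩
  obtain ⟨Q, hQ⟩ := loc3d u k
  rw [hQ] at hy
  have h30 : ¬ (3 : ℤ) ∣ u ^ 30 := fun h => hu3 (p3.dvd_of_dvd_pow h)
  have : (3 * z) ^ 2 = 3 * (3 * z ^ 2) := by ring
  omega

end C38

namespace C38
open NumberField

/-- Coordinate vectors with respect to the powers of `th`. -/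
abbrev V := ℤ × ℤ × ℤ × ℤ × ℤ

noncomputable def el (x : V) : 𝓞 K :=
  (x.1 : 𝓞 K) + x.2.1 * th + x.2.2.1 * th ^ 2 + x.2.2.2.1 * th ^ 3 + x.2.2.2.2 * th ^ 4

def subV (x y : V) : V :=
  (x.1 - y.1, x.2.1 - y.2.1, x.2.2.1 - y.2.2.1, x.2.2.2.1 - y.2.2.2.1, x.2.2.2.2 - y.2.2.2.2)

def NV (x : V) : ℤ := N5 x.1 x.2.1 x.2.2.1 x.2.2.2.1 x.2.2.2.2

def redV (p0 p1 p2 p3 p4 p5 p6 p7 p8 : ℤ) : V :=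
  (p0 + 6 * p5 + 60 * p8, p1 + 15 * p5 + 6 * p6 + 150 * p8,
    p2 + 10 * p5 + 15 * p6 + 6 * p7 + 100 * p8, p3 + 10 * p6 + 15 * p7 + 6 * p8,
    p4 + 10 * p7 + 15 * p8)

def mulV (x y : V) : V :=
  redV (x.1 * y.1) (x.1 * y.2.1 + x.2.1 * y.1)
    (x.1 * y.2.2.1 + x.2.1 * y.2.1 + x.2.2.1 * y.1)
    (x.1 * y.2.2.2.1 + x.2.1 * y.2.2.1 + x.2.2.1 * y.2.1 + x.2.2.2.1 * y.1)
    (x.1 * y.2.2.2.2 + x.2.1 * y.2.2.2.1 + x.2.2.1 * y.2.2.1 + x.2.2.2.1 * y.2.1 +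
      x.2.2.2.2 * y.1)
    (x.2.1 * y.2.2.2.2 + x.2.2.1 * y.2.2.2.1 + x.2.2.2.1 * y.2.2.1 + x.2.2.2.2 * y.2.1)
    (x.2.2.1 * y.2.2.2.2 + x.2.2.2.1 * y.2.2.2.1 + x.2.2.2.2 * y.2.2.1)
    (x.2.2.2.1 * y.2.2.2.2 + x.2.2.2.2 * y.2.2.2.1)
    (x.2.2.2.2 * y.2.2.2.2)

theorem el_sub (x y : V) : el (subV x y) = el x - el y := by
  simp only [el, subV]
  push_cast
  ring

theorem el_redV (p0 p1 p2 p3 p4 p5 p6 p7 p8 : ℤ) : el (redV p0 p1 p2 p3 p4 p5 p6 p7 p8) =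
    p0 + p1 * th + p2 * th ^ 2 + p3 * th ^ 3 + p4 * th ^ 4 + p5 * th ^ 5 + p6 * th ^ 6 +
      p7 * th ^ 7 + p8 * th ^ 8 := by
  simp only [el, redV]
  push_cast
  linear_combination (-((p5 : 𝓞 K) + p6 * th + p7 * th ^ 2 + p8 * (th ^ 3 + 10))) * th_eq

theorem el_mul (x y : V) : el (mulV x y) = el x * el y := by
  simp only [mulV, el_redV]
  simp only [el]
  push_cast
  ring

theorem el_one : el (1, 0, 0, 0, 0) = 1 := by simp [el]

theorem norm_el (x : V) : Algebra.norm ℤ (el x) = NV x := norm_Z _ _ _ _ _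

theorem unit_of_norm (x : 𝓞 K) (h : (Algebra.norm ℤ x).natAbs = 1) : IsUnit x := by
  rw [← Ideal.span_singleton_eq_top, ← Ideal.absNorm_eq_one_iff, Ideal.absNorm_span_singleton]
  exact h

theorem norm_of_unit (x : 𝓞 K) (h : IsUnit x) : (Algebra.norm ℤ x).natAbs = 1 := by
  rw [← Ideal.span_singleton_eq_top, ← Ideal.absNorm_eq_one_iff,
    Ideal.absNorm_span_singleton] at h
  exact h

/-- The element of norm `2` used for the final congruences. -/
noncomputable def pi0 : 𝓞 K := el (1, 1, 0, 0, 0)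

theorem norm_pi0 : (Algebra.norm ℤ pi0).natAbs = 2 := by
  rw [pi0, norm_el]; decide +kernel

theorem residue (x : 𝓞 K) : pi0 ∣ x ∨ pi0 ∣ x - 1 := by
  have hc : Nat.card (𝓞 K ⧸ Ideal.span {pi0}) = 2 := by
    have := Ideal.absNorm_span_singleton pi0
    rw [norm_pi0, Ideal.absNorm_apply, Submodule.cardQuot_apply] at this
    exact this
  obtain ⟨y, hy, hu⟩ := (Nat.card_eq_two_iff' (0 : 𝓞 K ⧸ Ideal.span {pi0})).1 hc
  have h1 : (1 : 𝓞 K ⧸ Ideal.span {pi0}) ≠ 0 := by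
    intro h
    have hs : Subsingleton (𝓞 K ⧸ Ideal.span {pi0}) := subsingleton_of_zero_eq_one h.symm
    exact hy (Subsingleton.elim _ _)
  have e1 := hu 1 h1
  by_cases hx : Ideal.Quotient.mk (Ideal.span {pi0}) x = 0
  · left
    rwa [Ideal.Quotient.eq_zero_iff_mem, Ideal.mem_span_singleton] at hx
  · right
    have e2 := hu _ hx
    have e3 : Ideal.Quotient.mk (Ideal.span {pi0}) x = Ideal.Quotient.mk (Ideal.span {pi0}) 1 := by
      rw [e2, map_one, e1]
    rwa [Ideal.Quotient.eq, Ideal.mem_span_singleton] at e3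

theorem pi0_not_unit : ¬ IsUnit pi0 := fun h => by
  have := norm_of_unit _ h
  rw [norm_pi0] at this
  omega

noncomputable def p0 : 𝓞 K := el (-2, -12, 1, -1, 1)

noncomputable def c0 : 𝓞 K := el (839, 1977, -591, -21, -39)

def e2 : V := (-43, -50, 2, -3, 5)

def e5 : V :=
  (251430994535335994192462904288223558374138526851430146353063215,
    726796635223427775174114716684470343323816003997124963587874123,
    702967914805206008966726264288229330101872724545685707507943181,
    274607792143099122796595441619566900780858495339079224466254229,
    107272946485194360105108127320320031383685664972504738206350253)

theorem el_two : el (2, 0, 0, 0, 0) = 2 := by simp [el]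

theorem el_five : el (5, 0, 0, 0, 0) = 5 := by simp [el]

theorem two_eq : (2 : 𝓞 K) = el e2 * (p0 * pi0 ^ 4) := by
  have h : (2, 0, 0, 0, 0) = mulV e2 (mulV (-2, -12, 1, -1, 1) (mulV (mulV (1, 1, 0, 0, 0) (1, 1, 0, 0, 0))
      (mulV (1, 1, 0, 0, 0) (1, 1, 0, 0, 0)))) := by decide +kernel
  have h2 := congrArg el h
  rw [el_two] at h2
  rw [h2]
  simp only [el_mul, p0, pi0]
  ring

theorem five_eq : (5 : 𝓞 K) = el e5 * c0 ^ 5 := by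
  have h : (5, 0, 0, 0, 0) = mulV e5 (mulV (839, 1977, -591, -21, -39)
      (mulV (mulV (839, 1977, -591, -21, -39) (839, 1977, -591, -21, -39))
        (mulV (839, 1977, -591, -21, -39) (839, 1977, -591, -21, -39)))) := by decide +kernel
  have h2 := congrArg el h
  rw [el_five] at h2
  rw [h2]
  simp only [el_mul, c0]
  ring

theorem e2_unit : IsUnit (el e2) := by
  apply unit_of_norm
  rw [norm_el]
  decide +kernel

theorem e5_unit : IsUnit (el e5) := by
  apply unit_of_norm
  rw [norm_el]
  decide +kernel

theorem pi0_pow_dvd_two : pi0 ^ 4 ∣ 2 := by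
  rw [two_eq]
  exact ⟨el e2 * p0, by ring⟩

/-- `1`, `1 + π`, `1 + π ^ 2`, `1 + π + π ^ 2`. -/
def sqL : List V := [(1, 0, 0, 0, 0), (2, 1, 0, 0, 0), (2, 2, 1, 0, 0), (3, 3, 1, 0, 0)]

theorem pi0_eq : pi0 = 1 + th := by simp [pi0, el]

theorem sq_mod (w : 𝓞 K) (hw : ¬ pi0 ∣ w) : ∃ a ∈ sqL, pi0 ^ 6 ∣ w ^ 2 - el a ^ 2 := by
  obtain ⟨r, hr⟩ := (residue w).resolve_left hw
  obtain ⟨k, hk⟩ := pi0_pow_dvd_two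
  have fin : ∀ a b : 𝓞 K, w = a + pi0 ^ 3 * b → pi0 ^ 6 ∣ w ^ 2 - a ^ 2 := by
    intro a b h
    refine ⟨pi0 * k * a * b + b ^ 2, ?_⟩
    rw [h]
    linear_combination (pi0 ^ 3 * a * b) * hk
  rcases residue r with ⟨r1, h1⟩ | ⟨r1, h1⟩ <;> rcases residue r1 with ⟨r2, h2⟩ | ⟨r2, h2⟩
  · refine ⟨(1, 0, 0, 0, 0), by simp [sqL], fin _ r2 ?_⟩
    simp only [el]; push_cast
    linear_combination hr + pi0 * h1 + pi0 ^ 2 * h2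
  · refine ⟨(2, 2, 1, 0, 0), by simp [sqL], fin _ r2 ?_⟩
    simp only [el]; push_cast
    linear_combination hr + pi0 * h1 + pi0 ^ 2 * h2 + (pi0 + 1 + th) * pi0_eq
  · refine ⟨(2, 1, 0, 0, 0), by simp [sqL], fin _ r2 ?_⟩
    simp only [el]; push_cast
    linear_combination hr + pi0 * h1 + pi0 ^ 2 * h2 + pi0_eq
  · refine ⟨(3, 3, 1, 0, 0), by simp [sqL], fin _ r2 ?_⟩
    simp only [el]; push_cast
    linear_combination hr + pi0 * h1 + pi0 ^ 2 * h2 + (pi0 + 2 + th) * pi0_eq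

/-- Value at `th = -1`, i.e. the residue modulo `pi0`. -/
def resV (x : V) : ℤ := x.1 - x.2.1 + x.2.2.1 - x.2.2.2.1 + x.2.2.2.2

/-- Division by `pi0` when `resV x` is even. -/
def divV (x : V) : V :=
  let c := resV x / 2
  (x.2.1 - x.2.2.1 + x.2.2.2.1 - x.2.2.2.2 + c * (-4), x.2.2.1 - x.2.2.2.1 + x.2.2.2.2 + c * (-11),
    x.2.2.2.1 - x.2.2.2.2 + c * (1), x.2.2.2.2 + c * (-1), c * (1))

def dvdV : ℕ → V → Bool
  | 0, _ => true
  | n + 1, x => decide (resV x % 2 = 0) && dvdV n (divV x)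

theorem two_eq' : pi0 * el (-4, -11, 1, -1, 1) = 2 := by
  have h : (2, 0, 0, 0, 0) = mulV (1, 1, 0, 0, 0) (-4, -11, 1, -1, 1) := by decide +kernel
  have h2 := congrArg el h
  rw [el_two, el_mul] at h2
  rw [h2, pi0]

theorem el_divV (x : V) (h : resV x % 2 = 0) : el x = pi0 * el (divV x) := by
  obtain ⟨c, hc⟩ := Int.dvd_of_emod_eq_zero h
  have hc2 : resV x / 2 = c := by omega
  have e : el x = (resV x : ℤ) + pi0 * el (x.2.1 - x.2.2.1 + x.2.2.2.1 - x.2.2.2.2,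
      x.2.2.1 - x.2.2.2.1 + x.2.2.2.2, x.2.2.2.1 - x.2.2.2.2, x.2.2.2.2, 0) := by
    rw [pi0_eq]
    simp only [el, resV]
    push_cast
    ring
  rw [e, hc]
  simp only [divV, hc2]
  push_cast
  rw [← two_eq']
  simp only [el]
  push_cast
  ring

theorem pi0_dvd_iff (x : V) (h : pi0 ∣ el x) : resV x % 2 = 0 := by
  by_contra hne
  have h1 : resV x % 2 = 1 := by omega
  have e : el x = (resV x : ℤ) + pi0 * el (x.2.1 - x.2.2.1 + x.2.2.2.1 - x.2.2.2.2,
      x.2.2.1 - x.2.2.2.1 + x.2.2.2.2, x.2.2.2.1 - x.2.2.2.2, x.2.2.2.2, 0) := by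
    rw [pi0_eq]
    simp only [el, resV]
    push_cast
    ring
  rw [e] at h
  have h2 := (dvd_add_left (Dvd.intro _ rfl)).1 h
  obtain ⟨c, hc⟩ : ∃ c, resV x = 2 * c + 1 := ⟨resV x / 2, by omega⟩
  rw [hc] at h2
  push_cast at h2
  have h3 : pi0 ∣ (2 : 𝓞 K) := ⟨_, two_eq'.symm⟩
  exact pi0_not_unit (isUnit_of_dvd_one ((dvd_add_right (h3.mul_right _)).1 h2))

theorem pi0_ne_zero : pi0 ≠ 0 := by
  intro h
  have := norm_pi0
  rw [h, Algebra.norm_zero] at this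
  simp at this

theorem dvdV_of_dvd (n : ℕ) : ∀ x : V, pi0 ^ n ∣ el x → dvdV n x = true := by
  induction n with
  | zero => intro x _; rfl
  | succ n ih =>
    intro x h
    have h0 := pi0_dvd_iff x ((dvd_pow_self _ (Nat.succ_ne_zero n)).trans h)
    have h1 : pi0 ^ n ∣ el (divV x) := by
      rw [el_divV x h0, pow_succ'] at h
      exact (mul_dvd_mul_iff_left pi0_ne_zero).1 h
    simp only [dvdV, Bool.and_eq_true, decide_eq_true_eq]
    exact ⟨h0, ih _ h1⟩

end C38

namespace C38
open NumberField

def u1 : V := (1, 1, -2, -2, 1)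

def u2 : V := (15929491, 31416491, -2261772, 2745939, -2971268)

/-- The eight unit representatives modulo squares. -/
def uV (x : Bool × Bool × Bool) : V :=
  mulV (if x.1 then (-1, 0, 0, 0, 0) else (1, 0, 0, 0, 0))
    (mulV (if x.2.1 then u1 else (1, 0, 0, 0, 0)) (if x.2.2 then u2 else (1, 0, 0, 0, 0)))

theorem uV_norm : ∀ x, (NV (uV x)).natAbs = 1 := by decide +kernel

theorem uV_unit (x) : IsUnit (el (uV x)) := by
  apply unit_of_norm
  rw [norm_el]
  exact uV_norm x

theorem uV_check : ∀ x y, x ≠ y → (NV (mulV (uV x) (uV y)) < 0 ∨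
    ∀ a ∈ sqL, dvdV 6 (subV (mulV (uV x) (uV y)) (mulV a a)) = false) := by
  decide +kernel

theorem uV_indep (x y) (h : x ≠ y) (η : 𝓞 K) (hη : el (uV x) * el (uV y) = η ^ 2) : False := by
  rw [← el_mul] at hη
  rcases uV_check x y h with h1 | h1
  · rw [← norm_el, hη, map_pow] at h1
    nlinarith [sq_nonneg (Algebra.norm ℤ η)]
  · have hun : IsUnit (η ^ 2) := by
      rw [← hη, el_mul]
      exact (uV_unit x).mul (uV_unit y)
    have hn : ¬ pi0 ∣ η := fun hd => pi0_not_unit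
      (isUnit_of_dvd_unit (hd.trans (dvd_pow_self _ two_ne_zero)) hun)
    obtain ⟨a, ha, hd⟩ := sq_mod η hn
    have h2 := dvdV_of_dvd 6 (subV (mulV (uV x) (uV y)) (mulV a a)) (by
      rw [el_sub, hη, el_mul, ← pow_two]; exact hd)
    rw [h1 a ha] at h2
    exact absurd h2 (by decide)

theorem rank_K : Units.rank K = 2 := by
  rw [Units.rank, InfinitePlace.card_eq_nrRealPlaces_add_nrComplexPlaces, nrComplex_eq.1,
    nrComplex_eq.2]

/-- The group of squares of units. -/
noncomputable def sqU : Subgroup (𝓞 K)ˣ := (powMonoidHom 2 : (𝓞 K)ˣ →* (𝓞 K)ˣ).range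

noncomputable def sig (p : Bool × (Fin (Units.rank K) → Bool)) : (𝓞 K)ˣ ⧸ sqU :=
  QuotientGroup.mk ((if p.1 then -1 else 1) *
    ∏ i, (Units.fundSystem K i) ^ (if p.2 i then (1 : ℤ) else 0))

theorem sig_surj : Function.Surjective sig := by
  classical
  intro q
  obtain ⟨x, rfl⟩ := QuotientGroup.mk_surjective q
  obtain ⟨⟨ζ, e⟩, hx, -⟩ := Units.exist_unique_eq_mul_prod K x
  dsimp only at hx
  have hodd : Odd (Module.finrank ℚ K) := by rw [finrank_K]; decide
  have hζ := Units.torsion_eq_one_or_neg_one_of_odd_finrank hodd ζ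
  refine ⟨⟨decide ((ζ : (𝓞 K)ˣ) = -1), fun i => decide (e i % 2 = 1)⟩, ?_⟩
  unfold sig
  rw [QuotientGroup.eq]
  refine ⟨∏ i, (Units.fundSystem K i) ^ (e i / 2), ?_⟩
  have h1 : (if decide ((ζ : (𝓞 K)ˣ) = -1) = true then (-1 : (𝓞 K)ˣ) else 1) = ζ := by
    rcases hζ with h | h
    · by_cases h2 : (ζ : (𝓞 K)ˣ) = -1
      · simp [h2]
      · simp [h2, h]
    · simp [h]
  dsimp only
  rw [h1, hx]
  have h2 : ∀ i, (Units.fundSystem K i) ^ (e i) =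
      (Units.fundSystem K i) ^ (if decide (e i % 2 = 1) = true then (1 : ℤ) else 0) *
        ((Units.fundSystem K i) ^ (e i / 2)) ^ 2 := by
    intro i
    rw [← zpow_natCast, ← zpow_mul, ← zpow_add]
    congr 1
    by_cases h : e i % 2 = 1
    · simp [h]; omega
    · simp [h]; omega
  rw [Finset.prod_congr rfl fun i _ => h2 i, Finset.prod_mul_distrib, Finset.prod_pow]
  simp only [powMonoidHom_apply]
  group

theorem unit_rep (ε : 𝓞 K) (hε : IsUnit ε) :
    ∃ x, ∃ η : 𝓞 K, IsUnit η ∧ ε = el (uV x) * η ^ 2 := by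
  have hfin : Finite ((𝓞 K)ˣ ⧸ sqU) := Finite.of_surjective _ sig_surj
  have hcard : Nat.card ((𝓞 K)ˣ ⧸ sqU) ≤ Nat.card (Bool × Bool × Bool) := by
    refine (Nat.card_le_card_of_surjective _ sig_surj).trans ?_
    simp [Nat.card_eq_fintype_card, rank_K]
  let f : Bool × Bool × Bool → (𝓞 K)ˣ ⧸ sqU := fun x => QuotientGroup.mk (uV_unit x).unit
  have hinj : Function.Injective f := by
    intro x y hxy
    by_contra hne
    have h1 := QuotientGroup.eq.1 hxy
    obtain ⟨η, hη⟩ := h1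
    refine uV_indep x y hne (el (uV x) * η) ?_
    have h2 : (uV_unit y).unit = (uV_unit x).unit * η ^ 2 := by
      simp only [powMonoidHom_apply] at hη
      rw [hη]; group
    have h3 := congrArg (Units.val) h2
    simp only [Units.val_mul, Units.val_pow_eq_pow_val, IsUnit.unit_spec] at h3
    rw [h3]; ring
  obtain ⟨x, hx⟩ := (hinj.bijective_of_nat_card_le hcard).2 (QuotientGroup.mk hε.unit)
  obtain ⟨η, hη⟩ := QuotientGroup.eq.1 hx
  refine ⟨x, η, η.isUnit, ?_⟩
  have h2 : hε.unit = (uV_unit x).unit * η ^ 2 := by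
    simp only [powMonoidHom_apply] at hη
    rw [hη]; group
  have h3 := congrArg (Units.val) h2
  simpa only [Units.val_mul, Units.val_pow_eq_pow_val, IsUnit.unit_spec] using h3

end C38

namespace C38
open NumberField

def sV (u v : ℤ) : V := (S0 u v, S1 u v, S2 u v, S3 u v, S4 u v)

theorem el_sV (u v : ℤ) : el (sV u v) = ss th (u : 𝓞 K) (v : 𝓞 K) := by
  simp only [el, sV, ss, S0, S1, S2, S3, S4]
  push_cast
  rfl

theorem ss_mod4 (u v : ℤ) : pi0 ^ 6 ∣ el (sV u v) - el (sV (u % 4) (v % 4)) := by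
  have h4 : pi0 ^ 6 ∣ 4 := by
    obtain ⟨k, hk⟩ := pi0_pow_dvd_two
    refine ⟨pi0 ^ 2 * k ^ 2, ?_⟩
    linear_combination (2 + pi0 ^ 4 * k) * hk
  refine h4.trans ?_
  rw [el_sV, el_sV, ← Ideal.mem_span_singleton, ← Ideal.Quotient.eq, map_ss, map_ss]
  have e : ∀ a : ℤ, Ideal.Quotient.mk (Ideal.span {(4 : 𝓞 K)}) (a : 𝓞 K) =
      Ideal.Quotient.mk (Ideal.span {(4 : 𝓞 K)}) ((a % 4 : ℤ) : 𝓞 K) := by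
    intro a
    rw [Ideal.Quotient.eq, Ideal.mem_span_singleton]
    refine ⟨((a / 4 : ℤ) : 𝓞 K), ?_⟩
    have := Int.emod_add_mul_ediv a 4
    have h2 := congrArg (Int.cast (R := 𝓞 K)) this
    push_cast at h2
    linear_combination -h2
  rw [e u, e v]

def pcV : V := mulV (-2, -12, 1, -1, 1) (839, 1977, -591, -21, -39)

theorem pcV_eq : el pcV = p0 * c0 := by rw [pcV, el_mul]; rfl

theorem main_check : ∀ u ∈ [(1 : ℤ), 3], ∀ v ∈ [(0 : ℤ), 1, 2, 3],
    resV (sV u v) % 2 = 1 ∧ ∀ x, ∀ a ∈ sqL,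
      dvdV 6 (subV (sV u v) (mulV (uV x) (mulV pcV (mulV a a)))) = false := by
  decide +kernel

theorem mem_u (u : ℤ) (hu : ∃ k, u = 2 * k + 1) : u % 4 ∈ [(1 : ℤ), 3] := by
  obtain ⟨k, rfl⟩ := hu
  have : (2 * k + 1) % 4 = 1 ∨ (2 * k + 1) % 4 = 3 := by omega
  rcases this with h | h <;> simp [h]

theorem mem_v (v : ℤ) : v % 4 ∈ [(0 : ℤ), 1, 2, 3] := by
  have : v % 4 = 0 ∨ v % 4 = 1 ∨ v % 4 = 2 ∨ v % 4 = 3 := by omega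
  rcases this with h | h | h | h <;> simp [h]

theorem pi0_not_dvd (u v : ℤ) (hu : ∃ k, u = 2 * k + 1) : ¬ pi0 ∣ el (sV u v) := by
  intro h
  have h1 : pi0 ∣ el (sV (u % 4) (v % 4)) := by
    have h2 := (dvd_pow_self pi0 (by norm_num : 6 ≠ 0)).trans (ss_mod4 u v)
    exact (dvd_sub_right h).1 h2
  have h3 := pi0_dvd_iff _ h1
  have h4 := (main_check _ (mem_u u hu) _ (mem_v v)).1
  omega

theorem final_contra (u v : ℤ) (hu : ∃ k, u = 2 * k + 1) (ε w : 𝓞 K) (hε : IsUnit ε)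
    (h : el (sV u v) = ε * (p0 * c0) * w ^ 2) : False := by
  obtain ⟨x, η, -, rfl⟩ := unit_rep ε hε
  have hw : ¬ pi0 ∣ η * w := by
    intro hd
    apply pi0_not_dvd u v hu
    rw [h]
    have : el (uV x) * η ^ 2 * (p0 * c0) * w ^ 2 =
      η * w * (el (uV x) * (p0 * c0) * (η * w)) := by ring
    rw [this]
    exact hd.mul_right _
  obtain ⟨a, ha, hd⟩ := sq_mod _ hw
  have h1 := (main_check _ (mem_u u hu) _ (mem_v v)).2 x a ha
  have h2 := dvdV_of_dvd 6 _ (?_ : pi0 ^ 6 ∣ el (subV (sV (u % 4) (v % 4))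
    (mulV (uV x) (mulV pcV (mulV a a)))))
  · rw [h1] at h2
    exact absurd h2 (by decide)
  · rw [el_sub, el_mul, el_mul, el_mul, pcV_eq]
    have h3 := dvd_sub (hd.mul_left (el (uV x) * (p0 * c0))) (ss_mod4 u v)
    rw [h] at h3
    convert h3 using 1
    ring

/-- Every nonzero element is a squarefree element times a square. -/
theorem sqfree_decomp {R : Type*} [CommRing R] [IsDomain R] [UniqueFactorizationMonoid R]
    (x : R) (hx : x ≠ 0) :
    ∃ d w : R, x = d * w ^ 2 ∧ ∀ q, Prime q → ¬ q * q ∣ d := by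
  induction x using UniqueFactorizationMonoid.induction_on_prime with
  | h₁ => exact absurd rfl hx
  | h₂ x hu =>
    refine ⟨x, 1, by ring, fun q hq h => hq.not_isUnit ?_⟩
    exact isUnit_of_dvd_unit ((Dvd.intro _ rfl).trans h) hu
  | h₃ a p ha hp ih =>
    obtain ⟨d, w, rfl, hd⟩ := ih ha
    by_cases hpd : p ∣ d
    · obtain ⟨e, rfl⟩ := hpd
      refine ⟨e, p * w, by ring, fun q hq h => hd q hq (h.mul_left _)⟩
    · refine ⟨p * d, w, by ring, fun q hq h => ?_⟩
      have h1 : q ∣ p * d := (Dvd.intro _ rfl).trans h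
      by_cases hqp : q ∣ p
      · have has : Associated q p := hq.irreducible.associated_of_dvd hp.irreducible hqp
        obtain ⟨c, rfl⟩ := has
        have h2 : q * q ∣ q * (c * d) := by
          convert h using 1
          ring
        have h3 := (mul_dvd_mul_iff_left hq.ne_zero).1 h2
        rw [Units.dvd_mul_left] at h3
        exact hpd ((Units.mul_right_dvd).2 h3)
      · apply hd q hq
        obtain ⟨e, rfl⟩ := (hq.dvd_or_dvd h1).resolve_left hqp
        have h2 : q * q ∣ q * (p * e) := by
          convert h using 1
          ring
        have h3 := (mul_dvd_mul_iff_left hq.ne_zero).1 h2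
        exact mul_dvd_mul_left _ ((hq.dvd_or_dvd h3).resolve_left hqp)

/-- Parity of multiplicities. -/
theorem parity {R : Type*} [CommRing R] [IsDomain R] [WfDvdMonoid R] (p m n a b : R)
    (hp : Prime p) (hm : ¬ p ∣ m) (hn : ¬ p ∣ n) (ha : a ≠ 0) (hb : b ≠ 0)
    (h : p * m * a ^ 2 = n * b ^ 2) : False := by
  obtain ⟨i, a', ha', rfl⟩ := WfDvdMonoid.max_power_factor ha hp.irreducible
  obtain ⟨j, b', hb', rfl⟩ := WfDvdMonoid.max_power_factor hb hp.irreducible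
  rcases Nat.lt_or_ge i j with hij | hij
  · obtain ⟨k, rfl⟩ := Nat.exists_eq_add_of_lt hij
    have h1 : p ^ (2 * i + 1) * (m * a' ^ 2) = p ^ (2 * i + 1) * (p * (n * p ^ (2 * k) * b' ^ 2)) := by
      linear_combination h
    have h2 := mul_left_cancel₀ (pow_ne_zero _ hp.ne_zero) h1
    rcases hp.dvd_or_dvd (Dvd.intro _ h2.symm) with h3 | h3
    · exact hm h3
    · exact ha' (hp.dvd_of_dvd_pow h3)
  · obtain ⟨k, rfl⟩ := Nat.exists_eq_add_of_le hij
    have h1 : p ^ (2 * j) * (p * (m * p ^ (2 * k) * a' ^ 2)) = p ^ (2 * j) * (n * b' ^ 2) := by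
      linear_combination h
    have h2 := mul_left_cancel₀ (pow_ne_zero _ hp.ne_zero) h1
    rcases hp.dvd_or_dvd (Dvd.intro _ h2) with h3 | h3
    · exact hn h3
    · exact hb' (hp.dvd_of_dvd_pow h3)

end C38

namespace C38
open NumberField

theorem assoc_of_dvd (q x : 𝓞 K) (hq : ¬ IsUnit q) (p : ℕ) (hp : p.Prime)
    (hx : (Algebra.norm ℤ x).natAbs = p) (h : q ∣ x) : Associated q x := by
  obtain ⟨r, rfl⟩ := h
  rw [map_mul, Int.natAbs_mul] at hx
  rw [← hx, Nat.prime_mul_iff] at hp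
  rcases hp with ⟨-, h1⟩ | ⟨-, h1⟩
  · obtain ⟨c, rfl⟩ := unit_of_norm r h1
    exact ⟨c, rfl⟩
  · exact absurd (unit_of_norm q h1) hq

theorem norm_p0 : Algebra.norm ℤ p0 = 2 := by
  rw [p0, norm_el]; decide +kernel

theorem norm_c0 : Algebra.norm ℤ c0 = 5 := by
  rw [c0, norm_el]; decide +kernel

theorem primes_of_d (u v y : ℤ) (hc : IsCoprime u v) (hy : y ^ 2 = - F u v) (d w : 𝓞 K)
    (hs : el (sV u v) = d * w ^ 2) (hs0 : el (sV u v) ≠ 0)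
    (hd : ∀ q, Prime q → ¬ q * q ∣ d) (q : 𝓞 K) (hq : Prime q) (hqd : q ∣ d) :
    Associated q p0 ∨ Associated q c0 := by
  obtain ⟨hu, hv, -, hy3⟩ := local_facts u v y hc hy
  have hqs : q ∣ el (sV u v) := by rw [hs]; exact hqd.mul_right _
  have hsT : 2 * (el (sV u v) * tt th (u : 𝓞 K) (v : 𝓞 K)) = -5 * (y : 𝓞 K) ^ 2 := by
    rw [el_sV, ss_tt th _ _ th_eq]
    have h1 := map_F (Int.castRingHom (𝓞 K)) u v
    simp only [eq_intCast] at h1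
    rw [← h1]
    have h2 := congrArg (Int.cast (R := 𝓞 K)) hy
    push_cast at h2
    linear_combination 5 * h2
  by_cases h2 : q ∣ 2
  · left
    rw [two_eq] at h2
    rcases hq.dvd_or_dvd h2 with h3 | h3
    · exact absurd (isUnit_of_dvd_unit h3 e2_unit) hq.not_isUnit
    rcases hq.dvd_or_dvd h3 with h4 | h4
    · exact assoc_of_dvd q p0 hq.not_isUnit 2 Nat.prime_two (by rw [norm_p0]; rfl) h4
    · have h5 := assoc_of_dvd q pi0 hq.not_isUnit 2 Nat.prime_two norm_pi0 (hq.dvd_of_dvd_pow h4)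
      exact absurd (h5.symm.dvd.trans hqs) (pi0_not_dvd u v hu)
  by_cases h5 : q ∣ 5
  · right
    rw [five_eq] at h5
    rcases hq.dvd_or_dvd h5 with h3 | h3
    · exact absurd (isUnit_of_dvd_unit h3 e5_unit) hq.not_isUnit
    · exact assoc_of_dvd q c0 hq.not_isUnit 5 Nat.prime_five (by rw [norm_c0]; rfl)
        (hq.dvd_of_dvd_pow h3)
  exfalso
  have n5 : ¬ q ∣ -5 := by rwa [dvd_neg]
  by_cases h3 : q ∣ 3
  · have h6 : q ∣ -5 * (y : 𝓞 K) ^ 2 := by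
      rw [← hsT]; exact (hqs.mul_right _).mul_left _
    have h7 := hq.dvd_of_dvd_pow ((hq.dvd_or_dvd h6).resolve_left n5)
    have hco : IsCoprime (3 : ℤ) y := (Prime.coprime_iff_not_dvd Int.prime_three).2 hy3
    have hco' := hco.map (Int.castRingHom (𝓞 K))
    simp only [eq_intCast] at hco'
    push_cast at hco'
    exact hq.not_isUnit (hco'.isUnit_of_dvd' h3 h7)
  have h30 : ¬ q ∣ 30 := by
    intro h
    have e : (30 : 𝓞 K) = 2 * (3 * 5) := by norm_num
    rw [e] at h
    rcases hq.dvd_or_dvd h with h | h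
    · exact h2 h
    · rcases hq.dvd_or_dvd h with h | h
      · exact h3 h
      · exact h5 h
  have hco := hc.map (Int.castRingHom (𝓞 K))
  simp only [eq_intCast] at hco
  refine no_common q th _ _ th_eq hq h30 hco (by rw [← el_sV]; exact hqs) ?_
  by_contra hT
  obtain ⟨e, rfl⟩ := hqd
  have he : ¬ q ∣ e := fun h => hd q hq (mul_dvd_mul_left _ h)
  have hy0 : (y : 𝓞 K) ≠ 0 := by
    intro h
    have : y = 0 := by exact_mod_cast h
    exact hy3 (this ▸ dvd_zero _)
  have hw0 : w ≠ 0 := by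
    rintro rfl
    exact hs0 (by rw [hs]; ring)
  refine parity q (2 * (e * tt th (u : 𝓞 K) (v : 𝓞 K))) (-5) w y hq ?_ n5 hw0 hy0 ?_
  · intro h
    rcases hq.dvd_or_dvd h with h | h
    · exact h2 h
    · rcases hq.dvd_or_dvd h with h | h
      · exact he h
      · exact hT h
  · rw [← hsT, hs]; ring

theorem split_off (d x : 𝓞 K) (P : 𝓞 K → Prop)
    (hd : ∀ q, Prime q → ¬ q * q ∣ d)
    (hP : ∀ q, Prime q → q ∣ d → Associated q x ∨ P q) :
    ∃ d', (d = x * d' ∨ d = d') ∧ ∀ q, Prime q → q ∣ d' → P q := by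
  by_cases h : x ∣ d
  · obtain ⟨e, rfl⟩ := h
    refine ⟨e, Or.inl rfl, fun q hq hqe => ?_⟩
    rcases hP q hq (hqe.mul_left _) with h1 | h1
    · exact absurd (mul_dvd_mul h1.dvd hqe) (hd q hq)
    · exact h1
  · refine ⟨d, Or.inr rfl, fun q hq hqd => ?_⟩
    rcases hP q hq hqd with h1 | h1
    · exact absurd (h1.symm.dvd.trans hqd) h
    · exact h1

theorem descent (u v y : ℤ) (hc : IsCoprime u v) (hy : y ^ 2 = - F u v) : False := by
  haveI := pid
  obtain ⟨hu, hv, -, hy3⟩ := local_facts u v y hc hy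
  have hy0 : y ≠ 0 := by
    rintro rfl
    exact hy3 (dvd_zero _)
  have hN : 2 * Algebra.norm ℤ (el (sV u v)) = 5 * y ^ 2 := by
    rw [norm_el, hy]
    have := normS u v
    simp only [NV, sV]
    linear_combination this
  have hs0 : el (sV u v) ≠ 0 := by
    intro h
    rw [h, Algebra.norm_zero] at hN
    have : y ^ 2 = 0 := by linarith
    exact hy0 (pow_eq_zero_iff two_ne_zero |>.1 this)
  obtain ⟨d, w, hs, hd⟩ := sqfree_decomp (el (sV u v)) hs0
  have hP := primes_of_d u v y hc hy d w hs hs0 hd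
  obtain ⟨d1, hd1, hP1⟩ := split_off d p0 (fun q => Associated q c0) hd hP
  have hd1' : d1 ∣ d := by
    rcases hd1 with h | h
    · rw [h]; exact Dvd.intro_left _ rfl
    · rw [h]
  obtain ⟨ε, hd2, hP2⟩ := split_off d1 c0 (fun _ => False)
    (fun q hq h => hd q hq (h.trans hd1')) (fun q hq h => Or.inl (hP1 q hq h))
  have hd0 : d ≠ 0 := by
    rintro rfl
    exact hs0 (by rw [hs]; ring)
  have hε0 : ε ≠ 0 := by
    rintro rfl
    apply hd0
    rcases hd1 with rfl | rfl <;> rcases hd2 with rfl | rfl <;> ring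
  have hε : IsUnit ε := by
    by_contra hne
    obtain ⟨q, hq, hqd⟩ := WfDvdMonoid.exists_irreducible_factor hne hε0
    exact hP2 q hq.prime hqd
  have hn := norm_of_unit ε hε
  have hsN := congrArg (Algebra.norm ℤ) hs
  rw [map_mul, map_pow] at hsN
  have hw0 : Algebra.norm ℤ w ≠ 0 := by
    intro h
    rw [hsN, h] at hN
    have : y ^ 2 = 0 := by linarith
    exact hy0 (pow_eq_zero_iff two_ne_zero |>.1 this)
  rw [hsN] at hN
  have he : Algebra.norm ℤ ε = 1 ∨ Algebra.norm ℤ ε = -1 := Int.natAbs_eq_iff.1 hn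
  rcases hd1 with rfl | rfl <;> rcases hd2 with rfl | rfl
  · exact final_contra u v hu ε w hε (by rw [hs]; ring)
  · rw [map_mul, norm_p0] at hN
    refine parity (5 : ℤ) 1 (4 * Algebra.norm ℤ d1) y (Algebra.norm ℤ w)
      (by norm_num) (by norm_num) ?_ hy0 hw0 (by linarith)
    rcases he with h | h <;> rw [h] <;> norm_num
  · rw [map_mul, norm_c0] at hN
    refine parity (2 : ℤ) (Algebra.norm ℤ ε) 1 (Algebra.norm ℤ w) y
      Int.prime_two ?_ (by norm_num) hw0 hy0 (by linarith)
    rcases he with h | h <;> rw [h] <;> norm_num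
  · refine parity (2 : ℤ) (Algebra.norm ℤ d) 5 (Algebra.norm ℤ w) y
      Int.prime_two ?_ (by norm_num) hw0 hy0 (by linarith)
    rcases he with h | h <;> rw [h] <;> norm_num

theorem no_points (u v y : ℤ) (h0 : (u, v) ≠ (0, 0)) (hy : y ^ 2 = - F u v) : False := by
  have hg : 0 < Int.gcd u v := by
    rw [Int.gcd_pos_iff]
    by_contra h
    push Not at h
    exact h0 (by rw [h.1, h.2])
  obtain ⟨g, u', v', hgp, h1, rfl, rfl⟩ := Int.exists_gcd_one' hg
  have hg0 : (g : ℤ) ≠ 0 := by exact_mod_cast hgp.ne'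
  rw [mul_comm u', mul_comm v', F_scale] at hy
  have h2 : ((g : ℤ) ^ 15) ^ 2 ∣ y ^ 2 := ⟨- F u' v', by rw [hy]; ring⟩
  obtain ⟨z, rfl⟩ := (Int.pow_dvd_pow_iff (by norm_num)).1 h2
  refine descent u' v' z (Int.isCoprime_iff_gcd_eq_one.2 h1) ?_
  apply mul_left_cancel₀ (pow_ne_zero 30 hg0)
  linear_combination hy

end C38

theorem rational_points_C38 :
    fC38.IsHomogeneous 30 ∧
    (∀ m : Fin 2 →₀ ℕ, ∃ z : ℤ, coeff m fC38 = (z : ℚ)) ∧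
    ¬ ∃ u v y : ℤ, (u, v) ≠ (0, 0) ∧
        (y : ℚ) ^ 2 = -eval ![(u : ℚ), (v : ℚ)] fC38 := by
  refine ⟨C38.fC38_hom, C38.fC38_int, ?_⟩
  rintro ⟨u, v, y, h0, h⟩
  rw [C38.fC38_eval] at h
  exact C38.no_points u v y h0 (by exact_mod_cast h)
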